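/- arXiv:1606.05861 — 3 statements merged into one kernel-verified Lean document; each statement's English description precedes it below -/
import Mathlib

section
/- There exist constants C > 0 and θ ∈ (0,1), both depending only on n, such that for all r > 0, a > 0, T > 0 and every u₀ ∈ C₀^∞(ℝⁿ;ℂ): ∫_{ℝⁿ} |u₀(x)|² dx ≤ C (1 + rⁿ/(aT)ⁿ) · ( ∫_{B_rᶜ(0)} |u(x,T;u₀)|² dx )^{θ^{1+r/(aT)}} · ( ∫_{ℝⁿ} e^{a|x|} |u₀(x)|² dx )^{1−θ^{1+r/(aT)}}. -/
open MeasureTheory Filter Metric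
open scoped Real RealInnerProductSpace ENNReal Topology

/-- The Fourier transform with the normalization
`f̂(ξ) = (2π)^{-n/2} ∫ f(x) e^{-i x·ξ} dx`. -/
noncomputable def fourierTransformPaper (n : ℕ) (f : EuclideanSpace ℝ (Fin n) → ℂ)
    (ξ : EuclideanSpace ℝ (Fin n)) : ℂ :=
  (((2 * Real.pi) ^ (-(n : ℝ) / 2) : ℝ) : ℂ) *
    ∫ x : EuclideanSpace ℝ (Fin n), Complex.exp (-Complex.I * (⟪x, ξ⟫ : ℝ)) * f x

/-- The solution `u(·,t;f) = e^{itΔ} f` of the free Schrödinger equation with (nice) initial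
datum `f`, obtained by Fourier inversion of `e^{-it|ξ|²} f̂(ξ)`. -/
noncomputable def schrodingerSol (n : ℕ) (f : EuclideanSpace ℝ (Fin n) → ℂ) (t : ℝ)
    (x : EuclideanSpace ℝ (Fin n)) : ℂ :=
  (((2 * Real.pi) ^ (-(n : ℝ) / 2) : ℝ) : ℂ) *
    ∫ ξ : EuclideanSpace ℝ (Fin n),
      Complex.exp (Complex.I * ((⟪x, ξ⟫ - t * ‖ξ‖ ^ 2 : ℝ) : ℂ)) * fourierTransformPaper n f ξ

/-- `f ∈ C₀^∞(ℝⁿ; ℂ)`. -/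
def IsTestFun (n : ℕ) (f : EuclideanSpace ℝ (Fin n) → ℂ) : Prop :=
  ContDiff ℝ (⊤ : ℕ∞) f ∧ HasCompactSupport f


lemma two_const (Φ : ℂ → ℂ) (hΦ : Differentiable ℂ Φ) (b d K E : ℝ) (hb : 0 < b) (hd : 0 < d)
    (hK : ∀ s : ℂ, |s.im| ≤ b → ‖Φ s‖ ≤ K) (hE : ∀ x : ℝ, d ≤ x → ‖Φ x‖ ≤ E) :
    ∃ κ : ℝ, (1 / π) * Real.exp (-(π * d / (2 * b))) ≤ κ ∧ κ < 1 ∧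
      ‖Φ 0‖ ≤ K ^ (1 - κ) * E ^ κ := by
  have hpi := Real.pi_pos
  set q := Real.exp (-(π * d / (2 * b))) with hq
  have hq0 : 0 < q := Real.exp_pos _
  have hq1 : q < 1 := by
    rw [hq, Real.exp_lt_one_iff]
    have : 0 < π * d / (2 * b) := by positivity
    linarith
  set α := Real.arcsin q with hα
  have hα0 : 0 < α := Real.arcsin_pos.2 hq0
  have hα1 : α < π / 2 := Real.arcsin_lt_pi_div_two.2 hq1
  have hsin : Real.sin α = q := Real.sin_arcsin (by linarith) hq1.le
  have hqα : q ≤ α := by rw [← hsin]; exact Real.sin_le hα0.le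
  let f : ℂ → ℂ := fun ζ => Φ (d + (2 * b / π : ℝ) * Complex.log (Complex.sin ζ))
  have hre : ∀ ζ : ℂ, α / 2 ≤ ζ.re → ζ.re ≤ π / 2 → 0 < (Complex.sin ζ).re := by
    intro ζ h1 h2
    have : (Complex.sin ζ).re = Real.sin ζ.re * Real.cosh ζ.im := by
      rw [Complex.sin_eq]
      simp [← Complex.ofReal_sin, ← Complex.ofReal_cosh, ← Complex.ofReal_cos, ← Complex.ofReal_sinh]
    rw [this]
    exact mul_pos (Real.sin_pos_of_pos_of_lt_pi (by linarith) (by linarith)) (Real.cosh_pos _)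
  have hbd : ∀ ζ : ℂ, α / 2 ≤ ζ.re → ζ.re ≤ π / 2 → ‖f ζ‖ ≤ K := by
    intro ζ h1 h2
    apply hK
    have h3 := Complex.abs_arg_le_pi_div_two_iff.2 (hre ζ h1 h2).le
    simp only [Complex.add_im, Complex.ofReal_im, Complex.re_ofReal_mul, Complex.im_ofReal_mul, Complex.log_im, zero_add, abs_mul]
    rw [abs_of_pos (by positivity)]
    calc 2 * b / π * |(Complex.sin ζ).arg| ≤ 2 * b / π * (π / 2) := by gcongr
      _ = b := by field_simp
  have key := Complex.HadamardThreeLines.norm_le_interp_of_mem_verticalClosedStrip'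
    (f := f) (z := (α : ℂ)) (a := K) (b := E) (l := α / 2) (u := π / 2) (by linarith)
    (by simp [Complex.HadamardThreeLines.verticalClosedStrip]; constructor <;> linarith)
    (by
      apply DifferentiableOn.diffContOnCl
      intro ζ hζ
      have hζ' : ζ.re ∈ Set.Icc (α / 2) (π / 2) := by
        have : closure (Complex.HadamardThreeLines.verticalStrip (α / 2) (π / 2)) ⊆
            Complex.re ⁻¹' Set.Icc (α / 2) (π / 2) := by
          apply closure_minimal
          · exact Set.preimage_mono Set.Ioo_subset_Icc_self
          · exact isClosed_Icc.preimage Complex.continuous_re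
        exact this hζ
      have h := hre ζ hζ'.1 hζ'.2
      apply DifferentiableAt.differentiableWithinAt
      apply (hΦ _).comp
      apply DifferentiableAt.const_add
      apply DifferentiableAt.const_mul
      exact Complex.differentiableAt_sin.clog (Or.inl h))
    (by
      refine ⟨K, ?_⟩
      rintro _ ⟨ζ, hζ, rfl⟩
      exact hbd ζ hζ.1 hζ.2)
    (by
      intro ζ hζ
      have : ζ.re = α / 2 := hζ
      exact hbd ζ this.ge (by linarith))
    (by
      intro ζ hζ
      have h1 : ζ.re = π / 2 := hζ
      have h2 : Complex.sin ζ = (Real.cosh ζ.im : ℝ) := by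
        rw [Complex.sin_eq, h1]
        simp [← Complex.ofReal_sin, ← Complex.ofReal_cos]
      have h3 : f ζ = Φ ((d + 2 * b / π * Real.log (Real.cosh ζ.im) : ℝ)) := by
        simp only [f, h2, ← Complex.ofReal_log (Real.cosh_pos _).le]
        push_cast; rfl
      rw [h3]
      apply hE
      have := Real.log_nonneg (Real.one_le_cosh ζ.im)
      have : 0 ≤ 2 * b / π * Real.log (Real.cosh ζ.im) := by positivity
      linarith)
  have hf0 : f α = Φ 0 := by
    simp only [f]
    congr 1
    rw [← Complex.ofReal_sin, hsin, ← Complex.ofReal_log hq0.le, hq, Real.log_exp]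
    norm_cast
    field_simp
    ring
  rw [hf0] at key
  refine ⟨_, ?_, ?_, key⟩
  · simp only [Complex.ofReal_re]
    rw [le_div_iff₀ (by linarith)]
    have : 1 / π * q * (π / 2 - α / 2) ≤ 1 / π * q * (π / 2) := by gcongr; linarith
    have e : 1 / π * q * (π / 2) = q / 2 := by field_simp
    linarith
  · simp only [Complex.ofReal_re]
    rw [div_lt_one (by linarith)]
    linarith

lemma entire_param {X : Type*} [MeasurableSpace X] (μ : Measure X) (G : X → ℂ) (ℓ : X → ℂ)
    (hG : Integrable G μ) (hℓ : AEStronglyMeasurable ℓ μ) (L : ℝ) (hL : ∀ x, G x ≠ 0 → ‖ℓ x‖ ≤ L) :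
    Differentiable ℂ (fun s : ℂ => ∫ x, Complex.exp (s * ℓ x) * G x ∂μ) := by
  intro s₀
  have hm : ∀ s : ℂ, AEStronglyMeasurable (fun x => Complex.exp (s * ℓ x) * G x) μ := fun s =>
    (Complex.continuous_exp.comp_aestronglyMeasurable (hℓ.const_mul s)).mul hG.1
  have hb : ∀ s ∈ ball s₀ 1, ∀ x, ‖Complex.exp (s * ℓ x)  * G x‖ ≤ Real.exp ((‖s₀‖ + 1) * L) * ‖G x‖ := by
    intro s hs x
    rw [norm_mul]
    by_cases h : G x = 0
    · simp [h]
    gcongr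
    refine (Complex.norm_exp_le_exp_norm _).trans (Real.exp_le_exp.2 ?_)
    rw [norm_mul]
    have h1 : ‖s‖ ≤ ‖s₀‖ + 1 := by
      have := norm_sub_norm_le s s₀
      rw [mem_ball, dist_eq_norm] at hs
      linarith
    gcongr
    exact hL x h
  refine (hasDerivAt_integral_of_dominated_loc_of_deriv_le
    (F := fun s x => Complex.exp (s * ℓ x) * G x)
    (F' := fun s x => ℓ x * (Complex.exp (s * ℓ x) * G x)) (s := ball s₀ 1)
    (bound := fun x => L * (Real.exp ((‖s₀‖ + 1) * L) * ‖G x‖))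
    (ball_mem_nhds _ one_pos) (Eventually.of_forall hm) ?_ (hℓ.mul (hm s₀)) ?_ ?_ ?_).2.differentiableAt
  · refine Integrable.mono' (hG.norm.const_mul _) (hm s₀) (Eventually.of_forall (hb s₀ (mem_ball_self one_pos)))
  · refine Eventually.of_forall fun x s hs => ?_
    by_cases h : G x = 0
    · simp [h]
    rw [norm_mul]
    have := hL x h
    have h0 : 0 ≤ L := (norm_nonneg _).trans this
    gcongr
    exact hb s hs x
  · exact (hG.norm.const_mul _).const_mul _
  · refine Eventually.of_forall fun x s hs => ?_
    have := (((hasDerivAt_id s).mul_const (ℓ x)).cexp).mul_const (G x)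
    convert! this using 1
    simp; ring

lemma cs {X : Type*} [MeasurableSpace X] (μ : Measure X) (f g : X → ℂ)
    (hf : MemLp f 2 μ) (hg : MemLp g 2 μ) :
    ‖∫ x, f x * g x ∂μ‖ ≤ (∫ x, ‖f x‖ ^ 2 ∂μ) ^ (1 / 2 : ℝ) * (∫ x, ‖g x‖ ^ 2 ∂μ) ^ (1 / 2 : ℝ) := by
  refine (norm_integral_le_integral_norm _).trans ?_
  simp only [norm_mul]
  have := integral_mul_norm_le_Lp_mul_Lq (μ := μ) (f := f) (g := g) (p := 2) (q := 2)
    Real.HolderConjugate.two_two (by simpa using hf) (by simpa using hg)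
  simpa using this

open FourierTransform in
lemma test_fourier {n : ℕ} {g : EuclideanSpace ℝ (Fin n) → ℂ} (hg : IsTestFun n g) :
    MemLp (𝓕 g) 2 ∧ Continuous (𝓕 g) ∧ Integrable (𝓕 g) ∧ ∫ ξ, ‖𝓕 g ξ‖ ^ 2 = ∫ x, ‖g x‖ ^ 2 := by
  let S := hg.2.toSchwartzMap hg.1
  have h : 𝓕 g = (𝓕 S : SchwartzMap _ _) := by
    rw [SchwartzMap.fourier_coe]; rfl
  rw [h]
  exact ⟨SchwartzMap.memLp _ 2 _, SchwartzMap.continuous _, SchwartzMap.integrable _,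
    SchwartzMap.integral_norm_sq_fourier S⟩

lemma test_mul {n : ℕ} {g : EuclideanSpace ℝ (Fin n) → ℂ} (hg : IsTestFun n g)
    {k : EuclideanSpace ℝ (Fin n) → ℂ} (hk : ContDiff ℝ (⊤ : ℕ∞) k) :
    IsTestFun n (fun v => k v * g v) :=
  ⟨hk.mul hg.1, hg.2.mul_left⟩

open FourierTransform in
lemma core {n : ℕ} {g : EuclideanSpace ℝ (Fin n) → ℂ} (hg : IsTestFun n g)
    (e : EuclideanSpace ℝ (Fin n)) (he : ‖e‖ = 1) (ρ a : ℝ) (hρ : 0 < ρ) (ha : 0 < a) :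
    ∃ κ : ℝ, (1 / π) * Real.exp (-(4 * π ^ 2 * ρ / a)) ≤ κ ∧ κ < 1 ∧
      ∫ ξ in ball 0 ρ, ‖𝓕 g ξ‖ ^ 2 ≤ (∫ ξ in (closedBall 0 ρ)ᶜ, ‖𝓕 g ξ‖ ^ 2) ^ κ *
        (∫ x, Real.exp (a * ‖x‖) * ‖g x‖ ^ 2) ^ (1 - κ) := by
  have hpi := Real.pi_pos
  set F := 𝓕 g with hF
  obtain ⟨hF2, hFc, hF1, hFP⟩ := test_fourier hg
  rw [← hF] at hF2 hFc hF1 hFP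
  have hgi : Integrable g := hg.1.continuous.integrable_of_hasCompactSupport hg.2
  set B : Set (EuclideanSpace ℝ (Fin n)) := ball 0 ρ with hB
  set ℓ : EuclideanSpace ℝ (Fin n) → ℂ := fun v => -2 * π * Complex.I * (⟪e, v⟫ : ℝ) with hℓ
  have hℓs : ContDiff ℝ (⊤ : ℕ∞) ℓ := by
    have : ContDiff ℝ (⊤ : ℕ∞) (fun v : EuclideanSpace ℝ (Fin n) => ((⟪e, v⟫ : ℝ) : ℂ)) :=
      Complex.ofRealCLM.contDiff.comp (contDiff_const.inner ℝ contDiff_id)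
    exact contDiff_const.mul this
  set h : ℂ → EuclideanSpace ℝ (Fin n) → ℂ := fun s v => Complex.exp (s * ℓ v) * g v with hh
  have hht : ∀ s, IsTestFun n (h s) := fun s =>
    test_mul hg (Complex.contDiff_exp.comp (contDiff_const.mul hℓs))
  let Φ : ℂ → ℂ := fun s => ∫ ξ in B, (starRingEnd ℂ) (F ξ) * 𝓕 (h s) ξ
  set m := ∫ ξ in B, ‖F ξ‖ ^ 2 with hm
  set E := ∫ ξ in (closedBall 0 ρ)ᶜ, ‖F ξ‖ ^ 2 with hE
  set M := ∫ x, Real.exp (a * ‖x‖) * ‖g x‖ ^ 2 with hM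
  have hm0 : 0 ≤ m := integral_nonneg fun _ => by positivity
  have hE0 : 0 ≤ E := integral_nonneg fun _ => by positivity
  have hM0 : 0 ≤ M := integral_nonneg fun _ => by positivity
  have hFstar : MemLp (fun ξ => (starRingEnd ℂ) (F ξ)) 2 (volume.restrict B) := by
    have := (hF2.restrict B).star
    exact this
  -- Cauchy Schwarz
  have hCS : ∀ s, ‖Φ s‖ ≤ m ^ (1 / 2 : ℝ) * (∫ ξ in B, ‖𝓕 (h s) ξ‖ ^ 2) ^ (1 / 2 : ℝ) := by
    intro s
    have := cs (volume.restrict B) _ _ hFstar ((test_fourier (hht s)).1.restrict B)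
    simpa using this
  have hΦd : Differentiable ℂ Φ := by
    let G : EuclideanSpace ℝ (Fin n) × EuclideanSpace ℝ (Fin n) → ℂ := fun p =>
      (𝐞 (-⟪p.2, p.1⟫) : ℂ) * ((starRingEnd ℂ) (F p.1) * g p.2)
    have hG : Integrable G ((volume.restrict B).prod volume) := by
      have h1 : Integrable (fun p : EuclideanSpace ℝ (Fin n) × EuclideanSpace ℝ (Fin n) =>
        (starRingEnd ℂ) (F p.1) * g p.2) ((volume.restrict B).prod volume) := by
        refine Integrable.mul_prod (f := fun ξ => (starRingEnd ℂ) (F ξ)) ?_ hgi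
        exact (Complex.conjCLE.toContinuousLinearMap.integrable_comp (hF1.restrict (s := B)))
      refine h1.norm.mono' ?_ (Eventually.of_forall fun p => ?_)
      · refine AEStronglyMeasurable.mul (Continuous.aestronglyMeasurable ?_) h1.1
        have : Continuous fun p : EuclideanSpace ℝ (Fin n) × EuclideanSpace ℝ (Fin n) => -⟪p.2, p.1⟫ := by fun_prop
        exact continuous_subtype_val.comp (Real.continuous_fourierChar.comp this)
      · simp only [G]
        rw [norm_mul, Circle.norm_coe, one_mul]
    obtain ⟨L, hL⟩ : ∃ L, ∀ v, g v ≠ 0 → ‖ℓ v‖ ≤ L := by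
      obtain ⟨L, hL⟩ := hg.2.isCompact.exists_bound_of_continuousOn hℓs.continuous.continuousOn
      exact ⟨L, fun v hv => hL v (subset_tsupport _ hv)⟩
    have hd := entire_param ((volume.restrict B).prod volume) G (fun p => ℓ p.2) hG
      (hℓs.continuous.comp continuous_snd).aestronglyMeasurable L (fun p hp => hL _ (by
        intro h0; apply hp; simp [G, h0]))
    convert hd using 2 with s
    have hint : Integrable (fun p => Complex.exp (s * ℓ p.2) * G p) ((volume.restrict B).prod volume) := by
      refine Integrable.mono' (hG.norm.const_mul (Real.exp (‖s‖ * L))) ?_ (Eventually.of_forall fun p => ?_)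
      · refine AEStronglyMeasurable.mul (Continuous.aestronglyMeasurable ?_) hG.1
        have := hℓs.continuous
        fun_prop
      · rw [norm_mul]
        by_cases h0 : g p.2 = 0
        · simp [G, h0]
        gcongr
        refine (Complex.norm_exp_le_exp_norm _).trans (Real.exp_le_exp.2 ?_)
        rw [norm_mul]
        gcongr
        exact hL _ h0
    rw [integral_prod _ hint]
    refine integral_congr_ae (Eventually.of_forall fun ξ => ?_)
    simp only [Real.fourier_eq, hh, G]
    rw [← integral_const_mul]
    refine integral_congr_ae (Eventually.of_forall fun v => ?_)
    simp only [Circle.smul_def, smul_eq_mul]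
    ring
  have hK : ∀ s : ℂ, |s.im| ≤ a / (4 * π) → ‖Φ s‖ ≤ m ^ (1 / 2 : ℝ) * M ^ (1 / 2 : ℝ) := by
    intro s hs
    refine (hCS s).trans ?_
    obtain ⟨hs2, -, -, hsP⟩ := test_fourier (hht s)
    have hi : Integrable (fun ξ => ‖𝓕 (h s) ξ‖ ^ 2) := hs2.integrable_norm_pow (by norm_num)
    gcongr
    calc ∫ ξ in B, ‖𝓕 (h s) ξ‖ ^ 2 ≤ ∫ ξ, ‖𝓕 (h s) ξ‖ ^ 2 :=
          setIntegral_le_integral hi (Eventually.of_forall fun _ => by positivity)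
      _ = ∫ x, ‖h s x‖ ^ 2 := hsP
      _ ≤ M := by
        refine integral_mono_of_nonneg (Eventually.of_forall fun _ => by positivity) ?_
          (Eventually.of_forall fun v => ?_)
        · refine Continuous.integrable_of_hasCompactSupport ?_ ?_
          · have := hg.1.continuous
            fun_prop
          · refine hg.2.mono fun v hv => ?_
            intro h0
            apply hv
            simp [h0]
        · simp only [hh, norm_mul, mul_pow]
          gcongr
          rw [Complex.norm_exp, ← Real.exp_nat_mul]
          apply Real.exp_le_exp.2
          have h1 : (s * ℓ v).re = 2 * π * s.im * ⟪e, v⟫ := by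
            simp [hℓ]; ring
          rw [h1]
          have h2 : |⟪e, v⟫| ≤ ‖v‖ := by
            have := abs_real_inner_le_norm e v
            rwa [he, one_mul] at this
          have h3 : s.im * ⟪e, v⟫ ≤ a / (4 * π) * ‖v‖ := by
            refine (le_abs_self _).trans ?_
            rw [abs_mul]
            gcongr
          push_cast
          calc 2 * (2 * π * s.im * ⟪e, v⟫) = 4 * π * (s.im * ⟪e, v⟫) := by ring
            _ ≤ 4 * π * (a / (4 * π) * ‖v‖) := by gcongr
            _ = a * ‖v‖ := by field_simp
  have htr : ∀ (x : ℝ) ξ, 𝓕 (h x) ξ = F (ξ + x • e) := by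
    intro x ξ
    simp only [hF, Real.fourier_eq, hh]
    refine integral_congr_ae (Eventually.of_forall fun v => ?_)
    simp only [Circle.smul_def, smul_eq_mul, Real.fourierChar_apply]
    rw [← mul_assoc, ← Complex.exp_add]
    congr 2
    simp only [hℓ, inner_add_right, inner_smul_right, real_inner_comm v e]
    push_cast
    ring
  have hEb : ∀ x : ℝ, 2 * ρ ≤ x → ‖Φ x‖ ≤ m ^ (1 / 2 : ℝ) * E ^ (1 / 2 : ℝ) := by
    intro x hx
    refine (hCS x).trans ?_
    simp only [htr]
    gcongr
    have hFi : Integrable (fun ξ => ‖F ξ‖ ^ 2) := hF2.integrable_norm_pow (by norm_num)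
    have hmeas : MeasurableSet ((closedBall (0 : EuclideanSpace ℝ (Fin n)) ρ)ᶜ) :=
      isClosed_closedBall.measurableSet.compl
    rw [hE, ← integral_indicator isOpen_ball.measurableSet, ← integral_indicator hmeas,
      ← integral_add_right_eq_self (Set.indicator (closedBall 0 ρ)ᶜ _) (x • e)]
    refine integral_mono_of_nonneg (Eventually.of_forall fun ξ => ?_) ?_
      (Eventually.of_forall fun ξ => ?_)
    · exact Set.indicator_nonneg (fun _ _ => by positivity) _
    · exact (hFi.indicator hmeas).comp_add_right (x • e)
    · simp only
      by_cases hξ : ξ ∈ B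
      · rw [Set.indicator_of_mem hξ, Set.indicator_of_mem]
        simp only [hB, mem_ball, dist_zero_right, Set.mem_compl_iff, mem_closedBall, not_le] at hξ ⊢
        have h1 : ‖x • e‖ = x := by rw [norm_smul, he, mul_one, Real.norm_of_nonneg (by linarith)]
        have h2 : ‖x • e‖ ≤ ‖ξ + x • e‖ + ‖ξ‖ := by
          have := norm_sub_le (ξ + x • e) ξ
          simpa using this
        linarith
      · rw [Set.indicator_of_notMem hξ]
        exact Set.indicator_nonneg (fun _ _ => by positivity) _
  obtain ⟨κ, hκ1, hκ2, hκ⟩ := two_const Φ hΦd (a / (4 * π)) (2 * ρ) _ _ (by positivity)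
    (by positivity) hK hEb
  have hexp : π * (2 * ρ) / (2 * (a / (4 * π))) = 4 * π ^ 2 * ρ / a := by
    field_simp
  rw [hexp] at hκ1
  refine ⟨κ, hκ1, hκ2, ?_⟩
  have hκ0 : 0 < κ := lt_of_lt_of_le (by positivity) hκ1
  have hΦ0 : Φ 0 = (m : ℂ) := by
    have h0 : ∀ ξ, 𝓕 (h 0) ξ = F ξ := by
      intro ξ
      have := htr 0 ξ
      simpa using this
    simp only [Φ, h0, hm]
    rw [← integral_complex_ofReal]
    refine integral_congr_ae (Eventually.of_forall fun ξ => ?_)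
    simp only
    rw [mul_comm, Complex.mul_conj, Complex.normSq_eq_norm_sq]
  rw [hΦ0, Complex.norm_real, Real.norm_of_nonneg hm0,
    Real.mul_rpow (by positivity) (by positivity), Real.mul_rpow (by positivity) (by positivity)] at hκ
  simp only [← Real.rpow_mul hm0, ← Real.rpow_mul hE0, ← Real.rpow_mul hM0] at hκ
  rcases hm0.eq_or_lt with hz | hmp
  · rw [← hz]; positivity
  have h1 : m ^ (1 / 2 * (1 - κ)) * m ^ (1 / 2 * κ) = m ^ (1 / 2 : ℝ) := by
    rw [← Real.rpow_add hmp]; congr 1; ring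
  have h2 : m ^ (1 / 2 : ℝ) * m ^ (1 / 2 : ℝ) = m := by
    rw [← Real.rpow_add hmp]; norm_num
  have h3 : m ^ (1 / 2 : ℝ) * m ^ (1 / 2 : ℝ) ≤ m ^ (1 / 2 : ℝ) * (E ^ (1 / 2 * κ) * M ^ (1 / 2 * (1 - κ))) := by
    rw [h2]
    calc m ≤ _ := hκ
      _ = (m ^ (1 / 2 * (1 - κ)) * m ^ (1 / 2 * κ)) * (E ^ (1 / 2 * κ) * M ^ (1 / 2 * (1 - κ))) := by ring
      _ = _ := by rw [h1]
  have h4 := le_of_mul_le_mul_left h3 (by positivity)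
  calc m = (m ^ (1 / 2 : ℝ)) ^ 2 := by rw [sq, h2]
    _ ≤ (E ^ (1 / 2 * κ) * M ^ (1 / 2 * (1 - κ))) ^ 2 := by gcongr
    _ = _ := by
      rw [mul_pow, ← Real.rpow_mul_natCast hE0, ← Real.rpow_mul_natCast hM0]
      congr 2 <;> push_cast <;> ring

open FourierTransform in
lemma J_eq {n : ℕ} (f : EuclideanSpace ℝ (Fin n) → ℂ) (ξ : EuclideanSpace ℝ (Fin n)) :
    ∫ y, Complex.exp (-Complex.I * (⟪y, ξ⟫ : ℝ)) * f y = 𝓕 f ((2 * π)⁻¹ • ξ) := by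
  rw [Real.fourier_eq]
  refine integral_congr_ae (Eventually.of_forall fun v => ?_)
  simp only [Circle.smul_def, smul_eq_mul, Real.fourierChar_apply, inner_smul_right]
  congr 2
  have : (π : ℂ) ≠ 0 := by exact_mod_cast Real.pi_ne_zero
  push_cast
  field_simp

lemma gauss_eps {n : ℕ} {f : EuclideanSpace ℝ (Fin n) → ℂ} (hf : Integrable f)
    (b : ℂ) (hb : 0 < b.re) (x : EuclideanSpace ℝ (Fin n)) :
    ∫ ξ : EuclideanSpace ℝ (Fin n), Complex.exp (-b * ‖ξ‖ ^ 2 + Complex.I * (⟪x, ξ⟫ : ℝ)) *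
      (∫ y, Complex.exp (-Complex.I * (⟪y, ξ⟫ : ℝ)) * f y) =
    (π / b) ^ (n / 2 : ℂ) * ∫ y, Complex.exp (- ‖x - y‖ ^ 2 / (4 * b)) * f y := by
  have hint : Integrable (fun p : EuclideanSpace ℝ (Fin n) × EuclideanSpace ℝ (Fin n) =>
      Complex.exp (-b * ‖p.1‖ ^ 2 + Complex.I * (⟪x - p.2, p.1⟫ : ℝ)) * f p.2)
      (volume.prod volume) := by
    have h0 : Integrable (fun ξ : EuclideanSpace ℝ (Fin n) => Complex.exp (-b * ‖ξ‖ ^ 2)) := by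
      simpa using GaussianFourier.integrable_cexp_neg_mul_sq_norm_add hb 0
        (0 : EuclideanSpace ℝ (Fin n))
    refine (h0.mul_prod hf).norm.mono' ?_ (Eventually.of_forall fun p => ?_)
    · refine AEStronglyMeasurable.mul (Continuous.aestronglyMeasurable ?_) hf.1.comp_snd
      fun_prop
    · rw [norm_mul, norm_mul, Complex.norm_exp, Complex.norm_exp]
      simp
  have e1 : ∀ ξ y : EuclideanSpace ℝ (Fin n),
      Complex.exp (-b * ‖ξ‖ ^ 2 + Complex.I * (⟪x, ξ⟫ : ℝ)) *
        (Complex.exp (-Complex.I * (⟪y, ξ⟫ : ℝ)) * f y) =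
      Complex.exp (-b * ‖ξ‖ ^ 2 + Complex.I * (⟪x - y, ξ⟫ : ℝ)) * f y := by
    intro ξ y
    rw [← mul_assoc, ← Complex.exp_add, inner_sub_left]
    congr 2
    push_cast; ring
  simp only [← integral_const_mul, e1]
  rw [integral_integral_swap hint]
  refine integral_congr_ae (Eventually.of_forall fun y => ?_)
  simp only
  rw [integral_mul_const, GaussianFourier.integral_cexp_neg_mul_sq_norm_add hb]
  simp [mul_assoc]

open FourierTransform in
lemma gauss_lim {n : ℕ} {f : EuclideanSpace ℝ (Fin n) → ℂ} (hf : IsTestFun n f)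
    (T : ℝ) (hT : 0 < T) (x : EuclideanSpace ℝ (Fin n)) :
    ∫ ξ : EuclideanSpace ℝ (Fin n), Complex.exp (-(T * Complex.I) * ‖ξ‖ ^ 2 + Complex.I * (⟪x, ξ⟫ : ℝ)) *
      (∫ y, Complex.exp (-Complex.I * (⟪y, ξ⟫ : ℝ)) * f y) =
    (π / (T * Complex.I)) ^ (n / 2 : ℂ) *
      ∫ y, Complex.exp (- ‖x - y‖ ^ 2 / (4 * (T * Complex.I))) * f y := by
  have hfi : Integrable f := hf.1.continuous.integrable_of_hasCompactSupport hf.2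
  have hTI : (T * Complex.I : ℂ) ≠ 0 := by
    simp [hT.ne']
  have hb : Tendsto (fun ε : ℝ => (ε + T * Complex.I : ℂ)) (𝓝[>] 0) (𝓝 (T * Complex.I)) := by
    have : Continuous (fun ε : ℝ => (ε + T * Complex.I : ℂ)) := by fun_prop
    have := this.tendsto 0
    simp only [Complex.ofReal_zero, zero_add] at this
    exact this.mono_left nhdsWithin_le_nhds
  have hJ : Integrable (fun ξ : EuclideanSpace ℝ (Fin n) =>
      ∫ y, Complex.exp (-Complex.I * (⟪y, ξ⟫ : ℝ)) * f y) := by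
    simp only [J_eq]
    exact (test_fourier hf).2.2.1.comp_smul (by positivity)
  have hL : Tendsto (fun ε : ℝ => ∫ ξ : EuclideanSpace ℝ (Fin n),
      Complex.exp (-(ε + T * Complex.I) * ‖ξ‖ ^ 2 + Complex.I * (⟪x, ξ⟫ : ℝ)) *
      (∫ y, Complex.exp (-Complex.I * (⟪y, ξ⟫ : ℝ)) * f y)) (𝓝[>] 0)
      (𝓝 (∫ ξ : EuclideanSpace ℝ (Fin n),
      Complex.exp (-(T * Complex.I) * ‖ξ‖ ^ 2 + Complex.I * (⟪x, ξ⟫ : ℝ)) *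
      (∫ y, Complex.exp (-Complex.I * (⟪y, ξ⟫ : ℝ)) * f y))) := by
    refine tendsto_integral_filter_of_dominated_convergence _ ?_ ?_ hJ.norm ?_
    · refine Eventually.of_forall fun ε => ?_
      refine AEStronglyMeasurable.mul (Continuous.aestronglyMeasurable ?_) hJ.1
      fun_prop
    · filter_upwards [self_mem_nhdsWithin] with ε hε
      refine Eventually.of_forall fun ξ => ?_
      rw [norm_mul, Complex.norm_exp]
      refine mul_le_of_le_one_left (norm_nonneg _) (Real.exp_le_one_iff.2 ?_)
      have : (-(ε + T * Complex.I) * ‖ξ‖ ^ 2 + Complex.I * (⟪x, ξ⟫ : ℝ) : ℂ).re = - (ε * ‖ξ‖ ^ 2) := by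
        simp [← Complex.ofReal_pow]
      rw [this]
      have : 0 ≤ ε * ‖ξ‖ ^ 2 := mul_nonneg (le_of_lt hε) (by positivity)
      linarith
    · refine Eventually.of_forall fun ξ => ?_
      refine Tendsto.mul_const _ ?_
      refine (Complex.continuous_exp.tendsto _).comp ?_
      exact ((hb.neg).mul_const _).add_const _
  have hR : Tendsto (fun ε : ℝ => (π / (ε + T * Complex.I)) ^ (n / 2 : ℂ) *
      ∫ y, Complex.exp (- ‖x - y‖ ^ 2 / (4 * (ε + T * Complex.I))) * f y) (𝓝[>] 0)
      (𝓝 ((π / (T * Complex.I)) ^ (n / 2 : ℂ) *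
      ∫ y, Complex.exp (- ‖x - y‖ ^ 2 / (4 * (T * Complex.I))) * f y)) := by
    refine Tendsto.mul ?_ ?_
    · refine Tendsto.cpow (tendsto_const_nhds.div hb hTI) tendsto_const_nhds (Or.inr ?_)
      have : (π / (T * Complex.I) : ℂ) = ((-(π / T) : ℝ) : ℂ) * Complex.I := by
        have hT' : (T : ℂ) ≠ 0 := by exact_mod_cast hT.ne'
        push_cast
        field_simp
        simp
      rw [this]
      simp [hT.ne', Real.pi_ne_zero]
    · refine tendsto_integral_filter_of_dominated_convergence _ ?_ ?_ hfi.norm ?_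
      · refine Eventually.of_forall fun ε => ?_
        refine AEStronglyMeasurable.mul (Continuous.aestronglyMeasurable ?_) hfi.1
        fun_prop
      · filter_upwards [self_mem_nhdsWithin] with ε hε
        refine Eventually.of_forall fun y => ?_
        rw [norm_mul, Complex.norm_exp]
        refine mul_le_of_le_one_left (norm_nonneg _) (Real.exp_le_one_iff.2 ?_)
        have : (- ‖x - y‖ ^ 2 / (4 * (ε + T * Complex.I)) : ℂ) =
          ((-(‖x - y‖ ^ 2 / 4) : ℝ) : ℂ) * (ε + T * Complex.I)⁻¹ := by
          push_cast
          rw [div_eq_mul_inv, mul_inv]; ring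
        rw [this, Complex.re_ofReal_mul, Complex.inv_re]
        have h1 : (ε + T * Complex.I : ℂ).re = ε := by simp
        rw [h1]
        have h2 : 0 ≤ ε / Complex.normSq (ε + T * Complex.I) :=
          div_nonneg (le_of_lt hε) (Complex.normSq_nonneg _)
        have h3 : 0 ≤ ‖x - y‖ ^ 2 / 4 := by positivity
        nlinarith
      · refine Eventually.of_forall fun y => ?_
        refine Tendsto.mul_const _ ?_
        refine (Complex.continuous_exp.tendsto _).comp ?_
        exact tendsto_const_nhds.div (hb.const_mul 4) (by simp [hT.ne'])
  refine tendsto_nhds_unique hL (hR.congr' ?_)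
  filter_upwards [self_mem_nhdsWithin] with ε hε
  have hε' : 0 < ε := hε
  exact (gauss_eps hfi (ε + T * Complex.I) (by simpa using hε') x).symm

open FourierTransform in
lemma sol_norm {n : ℕ} {f : EuclideanSpace ℝ (Fin n) → ℂ} (hf : IsTestFun n f)
    (T : ℝ) (hT : 0 < T) (x : EuclideanSpace ℝ (Fin n)) :
    ‖schrodingerSol n f T x‖ ^ 2 = ((4 * π * T)⁻¹) ^ n *
      ‖𝓕 (fun y : EuclideanSpace ℝ (Fin n) => Complex.exp (Complex.I * ((‖y‖ ^ 2 / (4 * T) : ℝ) : ℂ)) * f y)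
        ((4 * π * T)⁻¹ • x)‖ ^ 2 := by
  have hpi := Real.pi_pos
  have hT' : (T : ℂ) ≠ 0 := by exact_mod_cast hT.ne'
  have hpi' : (π : ℂ) ≠ 0 := by exact_mod_cast hpi.ne'
  set c : ℝ := (2 * Real.pi) ^ (-(n : ℝ) / 2) with hc
  have e1 : schrodingerSol n f T x = c * (c * ∫ ξ : EuclideanSpace ℝ (Fin n),
      Complex.exp (-(T * Complex.I) * ‖ξ‖ ^ 2 + Complex.I * (⟪x, ξ⟫ : ℝ)) *
      (∫ y, Complex.exp (-Complex.I * (⟪y, ξ⟫ : ℝ)) * f y)) := by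
    unfold schrodingerSol fourierTransformPaper
    rw [← hc]
    congr 1
    rw [← integral_const_mul]
    refine integral_congr_ae (Eventually.of_forall fun ξ => ?_)
    simp only
    rw [mul_left_comm]
    congr 3
    push_cast
    ring
  have e2 : ‖∫ y : EuclideanSpace ℝ (Fin n), Complex.exp (- ‖x - y‖ ^ 2 / (4 * (T * Complex.I))) * f y‖ =
      ‖𝓕 (fun y : EuclideanSpace ℝ (Fin n) => Complex.exp (Complex.I * ((‖y‖ ^ 2 / (4 * T) : ℝ) : ℂ)) * f y)
        ((4 * π * T)⁻¹ • x)‖ := by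
    have : ∫ y : EuclideanSpace ℝ (Fin n), Complex.exp (- ‖x - y‖ ^ 2 / (4 * (T * Complex.I))) * f y =
        Complex.exp (((‖x‖ ^ 2 / (4 * T) : ℝ) : ℂ) * Complex.I) *
        𝓕 (fun y : EuclideanSpace ℝ (Fin n) => Complex.exp (Complex.I * ((‖y‖ ^ 2 / (4 * T) : ℝ) : ℂ)) * f y)
        ((4 * π * T)⁻¹ • x) := by
      rw [Real.fourier_eq, ← integral_const_mul]
      refine integral_congr_ae (Eventually.of_forall fun y => ?_)
      simp only [Circle.smul_def, smul_eq_mul, Real.fourierChar_apply, inner_smul_right]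
      have h0 : ∀ A B D : ℂ, A * (B * (D * f y)) = (A * B * D) * f y := by intros; ring
      rw [h0, ← Complex.exp_add, ← Complex.exp_add]
      congr 2
      have h1 : (‖x - y‖ : ℂ) ^ 2 = ((‖x‖ ^ 2 - 2 * ⟪x, y⟫ + ‖y‖ ^ 2 : ℝ) : ℂ) := by
        rw [← norm_sub_sq_real]; push_cast; rfl
      rw [h1, real_inner_comm x y, show (4 * (T * Complex.I) : ℂ) = (4 * T) * Complex.I by ring,
        ← div_div, div_eq_mul_inv _ Complex.I, Complex.inv_I]
      push_cast
      field_simp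
      ring
    rw [this, norm_mul, Complex.norm_exp_ofReal_mul_I, one_mul]
  have e3 : ‖(π / (T * Complex.I) : ℂ) ^ (n / 2 : ℂ)‖ = (π / T) ^ ((n : ℝ) / 2) := by
    have : (n / 2 : ℂ) = (((n : ℝ) / 2 : ℝ) : ℂ) := by push_cast; rfl
    rw [this, Complex.norm_cpow_real]
    simp [abs_of_pos hT, abs_of_pos hpi]
  rw [e1, gauss_lim hf T hT, norm_mul, norm_mul, norm_mul, e2, e3, Complex.norm_real,
    Real.norm_of_nonneg (by positivity)]
  have e4 : (c * (c * (π / T) ^ ((n : ℝ) / 2))) ^ 2 = ((4 * π * T)⁻¹) ^ n := by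
    have h1 : c * c = ((2 * π) ^ n)⁻¹ := by
      rw [hc, ← Real.rpow_add (by positivity), ← Real.rpow_natCast, ← Real.rpow_neg (by positivity)]
      congr 1; ring
    have h2 : ((π / T) ^ ((n : ℝ) / 2)) ^ 2 = (π / T) ^ n := by
      rw [← Real.rpow_mul_natCast (by positivity), ← Real.rpow_natCast]
      congr 1; push_cast; ring
    rw [← mul_assoc, mul_pow, h1, h2, ← inv_pow, ← pow_mul, mul_comm n 2, pow_mul, ← mul_pow]
    congr 1
    field_simp
    ring
  rw [← e4]
  ring

open FourierTransform in
open scoped Pointwise in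
lemma sol_int {n : ℕ} {f : EuclideanSpace ℝ (Fin n) → ℂ} (hf : IsTestFun n f)
    (T : ℝ) (hT : 0 < T) (r : ℝ) (hr : 0 < r) :
    ∫ x in (closedBall (0 : EuclideanSpace ℝ (Fin n)) r)ᶜ, ‖schrodingerSol n f T x‖ ^ 2 =
      ∫ ξ in (closedBall (0 : EuclideanSpace ℝ (Fin n)) ((4 * π * T)⁻¹ * r))ᶜ,
      ‖𝓕 (fun y : EuclideanSpace ℝ (Fin n) =>
        Complex.exp (Complex.I * ((‖y‖ ^ 2 / (4 * T) : ℝ) : ℂ)) * f y) ξ‖ ^ 2 := by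
  have hR : 0 < (4 * π * T)⁻¹ := by positivity
  have hset : (4 * π * T)⁻¹ • (closedBall (0 : EuclideanSpace ℝ (Fin n)) r)ᶜ =
      (closedBall (0 : EuclideanSpace ℝ (Fin n)) ((4 * π * T)⁻¹ * r))ᶜ := by
    ext x
    rw [Set.mem_smul_set_iff_inv_smul_mem₀ hR.ne', Set.mem_compl_iff, Set.mem_compl_iff,
      mem_closedBall, mem_closedBall, dist_zero_right, dist_zero_right, norm_smul,
      Real.norm_of_nonneg (inv_pos.2 hR).le, inv_mul_le_iff₀ hR]
  simp only [sol_norm hf T hT]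
  rw [integral_const_mul, Measure.setIntegral_comp_smul_of_pos volume
    (fun ξ => ‖𝓕 (fun y : EuclideanSpace ℝ (Fin n) =>
        Complex.exp (Complex.I * ((‖y‖ ^ 2 / (4 * T) : ℝ) : ℂ)) * f y) ξ‖ ^ 2) _ hR,
    hset]
  simp only [finrank_euclideanSpace, Fintype.card_fin, smul_eq_mul]
  rw [← mul_assoc, mul_inv_cancel₀ (by positivity), one_mul]

/-- Theorem 1.2 (i): there are `C = C(n) > 0` and `θ = θ(n) ∈ (0,1)` such that for all
`r, a, T > 0` and every `u₀ ∈ C₀^∞(ℝⁿ;ℂ)`,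
`∫|u₀|² ≤ C (1 + rⁿ/(aT)ⁿ) (∫_{B_r(0)ᶜ}|u(·,T;u₀)|²)^{θ^{1+r/(aT)}}
  (∫ e^{a|x|}|u₀|²)^{1-θ^{1+r/(aT)}}`. -/
theorem unique_continuation_one_point_in_time (n : ℕ) (hn : 1 ≤ n) :
    ∃ C > (0 : ℝ), ∃ θ : ℝ, θ ∈ Set.Ioo (0 : ℝ) 1 ∧
      ∀ r a T : ℝ, 0 < r → 0 < a → 0 < T →
        ∀ u₀ : EuclideanSpace ℝ (Fin n) → ℂ, IsTestFun n u₀ →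
          (∫ x, ‖u₀ x‖ ^ 2) ≤
            C * (1 + r ^ n / (a * T) ^ n) *
              (∫ x in (closedBall (0 : EuclideanSpace ℝ (Fin n)) r)ᶜ,
                  ‖schrodingerSol n u₀ T x‖ ^ 2) ^ (θ ^ (1 + r / (a * T))) *
              (∫ x, Real.exp (a * ‖x‖) * ‖u₀ x‖ ^ 2) ^ (1 - θ ^ (1 + r / (a * T))) := by
  have hpi := Real.pi_pos
  refine ⟨2, two_pos, Real.exp (-π), ⟨Real.exp_pos _, by simpa using hpi⟩, ?_⟩
  intro r a T hr ha hT u₀ hu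
  rw [sol_int hu T hT r hr]
  set g : EuclideanSpace ℝ (Fin n) → ℂ := fun y =>
        Complex.exp (Complex.I * ((‖y‖ ^ 2 / (4 * T) : ℝ) : ℂ)) * u₀ y with hgdef
  have hgn : ∀ x, ‖g x‖ = ‖u₀ x‖ := by
    intro x
    rw [hgdef]
    simp only
    rw [norm_mul, mul_comm Complex.I, Complex.norm_exp_ofReal_mul_I, one_mul]
  have hg : IsTestFun n g := by
    refine test_mul hu (Complex.contDiff_exp.comp (contDiff_const.mul ?_))
    exact Complex.ofRealCLM.contDiff.comp ((contDiff_id.norm_sq ℝ).div_const _)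
  set κ' : ℝ := Real.exp (-π) ^ (1 + r / (a * T)) with hκ'
  set ρ := (4 * π * T)⁻¹ * r with hρ
  have hρ0 : 0 < ρ := by positivity
  let e : EuclideanSpace ℝ (Fin n) := EuclideanSpace.single ⟨0, hn⟩ 1
  have he : ‖e‖ = 1 := by simp [e]
  obtain ⟨κ, hκ1, hκ2, hκ⟩ := core hg e he ρ a hρ0 ha
  obtain ⟨hF2, -, -, hFP⟩ := test_fourier hg
  have hFi : Integrable (fun ξ => ‖FourierTransform.fourier g ξ‖ ^ 2) :=
    hF2.integrable_norm_pow (by norm_num)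
  simp only [hgn] at hκ hFP
  rw [← hFP]
  set E := ∫ ξ in (closedBall 0 ρ)ᶜ, ‖FourierTransform.fourier g ξ‖ ^ 2 with hE
  set M := ∫ x, Real.exp (a * ‖x‖) * ‖u₀ x‖ ^ 2 with hM
  have hE0 : 0 ≤ E := integral_nonneg fun _ => by positivity
  have hEM : E ≤ M := by
    calc E ≤ ∫ ξ, ‖FourierTransform.fourier g ξ‖ ^ 2 :=
          setIntegral_le_integral hFi (Eventually.of_forall fun _ => by positivity)
      _ = ∫ x, ‖u₀ x‖ ^ 2 := hFP
      _ ≤ M := by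
        refine integral_mono_of_nonneg (Eventually.of_forall fun _ => by positivity) ?_
          (Eventually.of_forall fun v => ?_)
        · refine Continuous.integrable_of_hasCompactSupport ?_ ?_
          · have := hu.1.continuous
            fun_prop
          · refine hu.2.mono fun v hv => ?_
            intro h0
            apply hv
            simp [h0]
        · refine le_mul_of_one_le_left (by positivity) (Real.one_le_exp (by positivity))
  have hsplit : ∫ ξ, ‖FourierTransform.fourier g ξ‖ ^ 2 =
      (∫ ξ in ball 0 ρ, ‖FourierTransform.fourier g ξ‖ ^ 2) + E := by
    rw [← integral_add_compl (isClosed_closedBall (x := (0 : EuclideanSpace ℝ (Fin n)))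
      (ε := ρ)).measurableSet hFi]
    congr 1
    refine setIntegral_congr_set ?_
    rw [← ball_union_sphere]
    exact union_ae_eq_left_of_ae_eq_empty (ae_eq_empty.2 (Measure.addHaar_sphere_of_ne_zero volume _ hρ0.ne'))
  have hκ'κ : κ' ≤ κ := by
    refine le_trans ?_ hκ1
    have h1 : κ' = Real.exp (-π) * Real.exp (-(4 * π ^ 2 * ρ / a)) := by
      rw [hκ', ← Real.exp_mul, ← Real.exp_add]
      congr 1
      rw [hρ]
      field_simp
      ring
    rw [h1]
    gcongr
    rw [Real.exp_neg, one_div]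
    have := Real.add_one_le_exp π
    gcongr
    linarith
  have hκ'0 : 0 < κ' := by positivity
  have hfac : 1 ≤ 1 + r ^ n / (a * T) ^ n := by
    have : 0 ≤ r ^ n / (a * T) ^ n := by positivity
    linarith
  -- interpolation with a smaller exponent
  have hint : ∀ p : ℝ, κ' ≤ p → p ≤ 1 → E ^ p * M ^ (1 - p) ≤ E ^ κ' * M ^ (1 - κ') := by
    intro p hp hp1
    rcases hE0.eq_or_lt with hz | hE0'
    · rw [← hz, Real.zero_rpow (by linarith), Real.zero_rpow hκ'0.ne']; simp
    have hM0' : 0 < M := lt_of_lt_of_le hE0' hEM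
    have h1 : E ^ p = E ^ κ' * E ^ (p - κ') := by
      rw [← Real.rpow_add hE0']; congr 1; ring
    have h2 : M ^ (1 - κ') = M ^ (p - κ') * M ^ (1 - p) := by
      rw [← Real.rpow_add hM0']; congr 1; ring
    rw [h1, h2, mul_assoc]
    have := Real.rpow_le_rpow hE0 hEM (sub_nonneg.2 hp)
    gcongr
  have hA := hκ.trans (hint κ hκ'κ hκ2.le)
  have hB := hint 1 (by linarith) le_rfl
  simp only [Real.rpow_one, sub_self, Real.rpow_zero, mul_one] at hB
  rw [hsplit]
  have hM0 : 0 ≤ M := hE0.trans hEM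
  have hP : 0 ≤ E ^ κ' * M ^ (1 - κ') := by positivity
  nlinarith [mul_nonneg (sub_nonneg.2 hfac) hP]
end

section
/- Let α : (0,∞) → (0,∞) be an increasing function with α(s)/s → 0 as s → ∞. Then for all r > 0, a > 0, T > 0 and every γ ∈ (0,1), there is no constant C > 0 such that ∫_{ℝⁿ} |u₀(x)|² dx ≤ C · ( ∫_{B_rᶜ(0)} |u(x,T;u₀)|² dx )^{γ} · ( ∫_{ℝⁿ} e^{a α(|x|)} |u₀(x)|² dx )^{1−γ} holds for all u₀ ∈ C₀^∞(ℝⁿ;ℂ). -/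
open MeasureTheory Filter Metric
open scoped Real RealInnerProductSpace ENNReal Topology

section

lemma nuc_iteratedDeriv_cexp (c : ℂ) (i : ℕ) :
    iteratedDeriv i (fun t : ℝ => Complex.exp (c * t)) =
      fun t : ℝ => c ^ i * Complex.exp (c * t) := by
  induction i with
  | zero => simp
  | succ i ih =>
    rw [iteratedDeriv_succ, ih]
    ext t
    have h1 : HasDerivAt (fun t : ℝ => c * (t : ℂ)) c t := by
      simpa using (Complex.ofRealCLM.hasDerivAt (x := t)).const_mul c
    have h2 := (h1.cexp).const_mul (c ^ i)
    rw [h2.deriv]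
    ring

lemma nuc_norm_iteratedFDeriv_cexp (c : ℂ) (i : ℕ) (t : ℝ) :
    ‖iteratedFDeriv ℝ i (fun t : ℝ => Complex.exp (c * t)) t‖ =
      ‖c‖ ^ i * Real.exp (c.re * t) := by
  rw [norm_iteratedFDeriv_eq_norm_iteratedDeriv, nuc_iteratedDeriv_cexp, norm_mul, norm_pow,
    Complex.norm_exp]
  simp

lemma nuc_contDiff_cexp (c : ℂ) {N : WithTop ℕ∞} :
    ContDiff ℝ N (fun t : ℝ => Complex.exp (c * t)) :=
  (contDiff_const.mul Complex.ofRealCLM.contDiff).cexp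

lemma nuc_temperate (n : ℕ) (s : ℝ) :
    Function.HasTemperateGrowth
      (fun x : EuclideanSpace ℝ (Fin n) => Complex.exp (((s : ℂ) * Complex.I) * ((‖x‖ ^ 2 : ℝ) : ℂ))) := by
  have h1 : Function.HasTemperateGrowth (fun t : ℝ => Complex.exp (((s : ℂ) * Complex.I) * t)) := by
    refine ⟨nuc_contDiff_cexp _, fun i => ⟨0, ‖(s : ℂ) * Complex.I‖ ^ i, fun t => ?_⟩⟩
    rw [nuc_norm_iteratedFDeriv_cexp]
    simp
  exact h1.comp (Function.hasTemperateGrowth_norm_sq _)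

lemma nuc_poly_gauss {β : ℝ} (hβ : 0 < β) (N : ℕ) :
    ∃ K : ℝ, ∀ s : ℝ, 0 ≤ s → (1 + s) ^ N * Real.exp (-β * s ^ 2) ≤ K := by
  refine ⟨N.factorial * Real.exp (1 + 1 / (4 * β)), fun s hs => ?_⟩
  have h1 := Real.pow_div_factorial_le_exp (1 + s) (by linarith) N
  have hf : (0 : ℝ) < N.factorial := by positivity
  rw [div_le_iff₀ hf] at h1
  have h2 : 1 + s + (-β * s ^ 2) ≤ 1 + 1 / (4 * β) := by
    have : 1 / (4 * β) - s + β * s ^ 2 = (2 * β * s - 1) ^ 2 / (4 * β) := by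
      field_simp; ring
    have h3 : 0 ≤ (2 * β * s - 1) ^ 2 / (4 * β) := by positivity
    linarith
  calc (1 + s) ^ N * Real.exp (-β * s ^ 2)
      ≤ (Real.exp (1 + s) * N.factorial) * Real.exp (-β * s ^ 2) := by gcongr
    _ = N.factorial * Real.exp (1 + s + (-β * s ^ 2)) := by rw [Real.exp_add (1 + s)]; ring
    _ ≤ _ := by gcongr

/-- The complex Gaussian as a Schwartz function. -/
lemma nuc_gauss_schwartz (n : ℕ) (b : ℂ) (hb : 0 < b.re) :
    ∃ g : SchwartzMap (EuclideanSpace ℝ (Fin n)) ℂ,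
      ∀ x, g x = Complex.exp (-b * ((‖x‖ ^ 2 : ℝ) : ℂ)) := by
  let q : EuclideanSpace ℝ (Fin n) → ℝ := fun x => ‖x‖ ^ 2
  have hq : Function.HasTemperateGrowth q := Function.hasTemperateGrowth_norm_sq _
  let f : ℝ → ℂ := fun t => Complex.exp (-b * t)
  have hf : ContDiff ℝ (⊤ : ℕ∞) f := nuc_contDiff_cexp _
  refine ⟨⟨f ∘ q, hf.comp hq.1, ?_⟩, fun x => rfl⟩
  intro k m
  obtain ⟨l, D, hD, hDle⟩ := hq.norm_iteratedFDeriv_le_uniform m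
  obtain ⟨K, hK⟩ := nuc_poly_gauss hb (k + l * m)
  let c := max 1 ‖b‖ ^ m
  refine ⟨m.factorial * c * (max 1 D) ^ m * K, fun x => ?_⟩
  have h := norm_iteratedFDeriv_comp_le (n := m) (N := (⊤ : ℕ∞)) hf hq.1 (mod_cast le_top) x
    (C := c * Real.exp (-b.re * ‖x‖ ^ 2)) (D := max 1 D * (1 + ‖x‖) ^ l) ?_ ?_
  · have hx : ‖x‖ ^ k ≤ (1 + ‖x‖) ^ k := by gcongr; linarith
    calc ‖x‖ ^ k * ‖iteratedFDeriv ℝ m (f ∘ q) x‖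
        ≤ (1 + ‖x‖) ^ k * (m.factorial * (c * Real.exp (-b.re * ‖x‖ ^ 2)) *
            (max 1 D * (1 + ‖x‖) ^ l) ^ m) := by gcongr
      _ = m.factorial * c * (max 1 D) ^ m *
            ((1 + ‖x‖) ^ (k + l * m) * Real.exp (-b.re * ‖x‖ ^ 2)) := by
          rw [mul_pow, pow_add, ← pow_mul]; ring
      _ ≤ _ := by
          have := hK ‖x‖ (norm_nonneg _)
          gcongr
  · intro i hi
    rw [nuc_norm_iteratedFDeriv_cexp]
    simp only [norm_neg, Complex.neg_re, q]
    gcongr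
    calc ‖b‖ ^ i ≤ max 1 ‖b‖ ^ i := by gcongr; exact le_max_right _ _
      _ ≤ max 1 ‖b‖ ^ m := pow_le_pow_right₀ (le_max_left _ _) hi
  · intro i h1 hi
    have h0 : (1:ℝ) ≤ max 1 D * (1 + ‖x‖) ^ l := by
      have : (1:ℝ) ≤ (1 + ‖x‖) ^ l := one_le_pow₀ (by linarith [norm_nonneg x])
      nlinarith [le_max_left 1 D]
    calc _ ≤ D * (1 + ‖x‖) ^ l := hDle i hi x
      _ ≤ max 1 D * (1 + ‖x‖) ^ l := by gcongr; exact le_max_right _ _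
      _ ≤ _ := le_self_pow₀ h0 (by omega)

end

section
open SchwartzMap FourierTransform

/-- The Fourier multiplier of the free evolution in the normalization of Mathlib. -/
noncomputable def nucMult (n : ℕ) (T : ℝ) (x : EuclideanSpace ℝ (Fin n)) : ℂ :=
  Complex.exp (((-(4 * Real.pi ^ 2 * T) : ℝ) : ℂ) * Complex.I * ((‖x‖ ^ 2 : ℝ) : ℂ))

lemma nucMult_temperate (n : ℕ) (T : ℝ) : Function.HasTemperateGrowth (nucMult n T) :=
  nuc_temperate n _

lemma nuc_fourier (n : ℕ) (f : EuclideanSpace ℝ (Fin n) → ℂ) (η : EuclideanSpace ℝ (Fin n)) :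
    fourierTransformPaper n f ((2 * Real.pi) • η) =
      (((2 * Real.pi) ^ (-(n : ℝ) / 2) : ℝ) : ℂ) * 𝓕 f η := by
  rw [fourierTransformPaper, Real.fourier_eq']
  congr 2
  ext x
  rw [smul_eq_mul, inner_smul_right]
  congr 2
  push_cast
  ring

lemma nuc_sol_eq (n : ℕ) (T : ℝ) (f : SchwartzMap (EuclideanSpace ℝ (Fin n)) ℂ)
    (x : EuclideanSpace ℝ (Fin n)) :
    schrodingerSol n f T x = fourierMultiplierCLM ℂ (nucMult n T) f x := by
  rw [fourierMultiplierCLM_apply, fourierInv_coe, Real.fourierInv_eq', schrodingerSol]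
  have h2 : (0:ℝ) < 2 * Real.pi := by positivity
  have key := Measure.integral_comp_smul (volume : Measure (EuclideanSpace ℝ (Fin n)))
    (fun ξ => Complex.exp (Complex.I * ((⟪x, ξ⟫ - T * ‖ξ‖ ^ 2 : ℝ) : ℂ)) *
      fourierTransformPaper n f ξ) (2 * Real.pi)
  rw [finrank_euclideanSpace_fin, abs_of_pos (by positivity)] at key
  have hc : (∫ ξ, Complex.exp (Complex.I * ((⟪x, ξ⟫ - T * ‖ξ‖ ^ 2 : ℝ) : ℂ)) *
      fourierTransformPaper n f ξ) = (((2 * Real.pi) ^ n : ℝ) : ℂ) *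
      ∫ η, Complex.exp (Complex.I * ((⟪x, (2 * Real.pi) • η⟫ - T * ‖(2 * Real.pi) • η‖ ^ 2 : ℝ) : ℂ))
        * fourierTransformPaper n f ((2 * Real.pi) • η) := by
    rw [key, Complex.real_smul, ← mul_assoc, ← Complex.ofReal_mul, mul_inv_cancel₀ (by positivity)]
    simp
  rw [hc, ← integral_const_mul, ← integral_const_mul]
  congr 1
  ext η
  rw [nuc_fourier, smulLeftCLM_apply_apply (nucMult_temperate n T), smul_eq_mul, smul_eq_mul,
    nucMult, ← mul_assoc (Complex.exp _) (Complex.exp _), ← Complex.exp_add]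
  have e1 : (((2 * Real.pi) ^ (-(n : ℝ) / 2) : ℝ) : ℂ) * ((((2 * Real.pi) ^ n : ℝ) : ℂ) *
      (((2 * Real.pi) ^ (-(n : ℝ) / 2) : ℝ) : ℂ)) = 1 := by
    rw [← Complex.ofReal_mul, ← Complex.ofReal_mul, ← Real.rpow_natCast, ← Real.rpow_add h2,
      ← Real.rpow_add h2]
    have : -(n:ℝ)/2 + (n + -(n:ℝ)/2) = 0 := by ring
    rw [this]; simp
  have e2 : Complex.I * ((⟪x, (2 * Real.pi) • η⟫ - T * ‖(2 * Real.pi) • η‖ ^ 2 : ℝ) : ℂ) =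
      ((2 * Real.pi * ⟪η, x⟫ : ℝ) : ℂ) * Complex.I +
      ((-(4 * Real.pi ^ 2 * T) : ℝ) : ℂ) * Complex.I * ((‖η‖ ^ 2 : ℝ) : ℂ) := by
    rw [inner_smul_right, norm_smul, Real.norm_of_nonneg h2.le, real_inner_comm]
    push_cast
    ring
  rw [e2, fourier_coe]
  generalize Complex.exp _ = E
  linear_combination (E * 𝓕 (⇑f) η) * e1

lemma nuc_sol_norm (n : ℕ) (T : ℝ) (f : SchwartzMap (EuclideanSpace ℝ (Fin n)) ℂ) :
    ∫ x, ‖schrodingerSol n f T x‖ ^ 2 = ∫ x, ‖f x‖ ^ 2 := by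
  simp_rw [nuc_sol_eq]
  rw [fourierMultiplierCLM_apply, ← integral_norm_sq_fourier, fourier_fourierInv_eq,
    ← integral_norm_sq_fourier f]
  congr 1
  ext ξ
  rw [smulLeftCLM_apply_apply (nucMult_temperate n T), norm_smul]
  have : ‖nucMult n T ξ‖ = 1 := by
    rw [nucMult, mul_right_comm, ← Complex.ofReal_mul, Complex.norm_exp_ofReal_mul_I]
  rw [this, one_mul]

lemma nuc_schwartz_sq_integrable (n : ℕ) (f : SchwartzMap (EuclideanSpace ℝ (Fin n)) ℂ) :
    Integrable (fun x => ‖f x‖ ^ 2) := by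
  have := (f.memLp 2 volume).integrable_norm_pow (by norm_num)
  simpa using this

lemma nuc_sol_sq_integrable (n : ℕ) (T : ℝ) (f : SchwartzMap (EuclideanSpace ℝ (Fin n)) ℂ) :
    Integrable (fun x => ‖schrodingerSol n f T x‖ ^ 2) := by
  simp_rw [nuc_sol_eq]
  exact nuc_schwartz_sq_integrable n _

lemma nuc_sol_split (n : ℕ) (T : ℝ) (f g : SchwartzMap (EuclideanSpace ℝ (Fin n)) ℂ)
    (S : Set (EuclideanSpace ℝ (Fin n))) :
    ∫ x in S, ‖schrodingerSol n f T x‖ ^ 2 ≤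
      2 * (∫ x in S, ‖schrodingerSol n g T x‖ ^ 2) + 2 * ∫ x, ‖f x - g x‖ ^ 2 := by
  have h1 := nuc_sol_norm n T (f - g)
  have hi := nuc_sol_sq_integrable n T (f - g)
  have hg := nuc_sol_sq_integrable n T g
  calc ∫ x in S, ‖schrodingerSol n f T x‖ ^ 2
      ≤ ∫ x in S, (2 * ‖schrodingerSol n g T x‖ ^ 2 + 2 * ‖schrodingerSol n ⇑(f - g) T x‖ ^ 2) := by
        refine integral_mono_of_nonneg (Eventually.of_forall fun x => by positivity)
          ((hg.const_mul 2).add (hi.const_mul 2)).integrableOn (Eventually.of_forall fun x => ?_)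
        have e : schrodingerSol n f T x = schrodingerSol n g T x + schrodingerSol n ⇑(f - g) T x := by
          rw [nuc_sol_eq, nuc_sol_eq, nuc_sol_eq, map_sub, sub_apply]; ring
        simp only [e]
        have := norm_add_le (schrodingerSol n g T x) (schrodingerSol n ⇑(f - g) T x)
        nlinarith [sq_nonneg (‖schrodingerSol n g T x‖ - ‖schrodingerSol n ⇑(f - g) T x‖),
          norm_nonneg (schrodingerSol n g T x + schrodingerSol n ⇑(f - g) T x)]
    _ = 2 * (∫ x in S, ‖schrodingerSol n g T x‖ ^ 2) +
          2 * ∫ x in S, ‖schrodingerSol n ⇑(f - g) T x‖ ^ 2 := by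
        rw [integral_add (hg.const_mul 2).integrableOn (hi.const_mul 2).integrableOn,
          integral_const_mul, integral_const_mul]
    _ ≤ _ := by
        have := setIntegral_le_integral (s := S) hi (Eventually.of_forall fun x => by positivity)
        rw [h1] at this
        simp only [sub_apply] at this
        linarith

end

section

lemma nuc_limit (n : ℕ) (T C γ : ℝ) (hC : 0 < C) (hγ : γ ∈ Set.Ioo (0 : ℝ) 1)
    (S : Set (EuclideanSpace ℝ (Fin n))) (w h : EuclideanSpace ℝ (Fin n) → ℝ)
    (hw : ∀ x, 0 ≤ w x) (hh : Integrable h)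
    (H : ∀ u₀ : EuclideanSpace ℝ (Fin n) → ℂ, IsTestFun n u₀ →
          (∫ x, ‖u₀ x‖ ^ 2) ≤ C * (∫ x in S, ‖schrodingerSol n u₀ T x‖ ^ 2) ^ γ *
              (∫ x, w x * ‖u₀ x‖ ^ 2) ^ (1 - γ))
    (g : SchwartzMap (EuclideanSpace ℝ (Fin n)) ℂ) (hg : ∀ x, w x * ‖g x‖ ^ 2 ≤ h x) :
    (∫ x, ‖g x‖ ^ 2) ≤ C * (2 * ∫ x in S, ‖schrodingerSol n g T x‖ ^ 2) ^ γ *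
      (∫ x, h x) ^ (1 - γ) := by
  let χ : ℕ → ContDiffBump (0 : EuclideanSpace ℝ (Fin n)) := fun m =>
    ⟨(m : ℝ) + 1, (m : ℝ) + 2, by positivity, by linarith⟩
  let u : ℕ → EuclideanSpace ℝ (Fin n) → ℂ := fun m x => ((χ m x : ℝ) : ℂ) * g x
  have hsupp : ∀ m, HasCompactSupport (u m) := fun m => by
    have h1 : HasCompactSupport (fun x => ((χ m x : ℝ) : ℂ)) :=
      (χ m).hasCompactSupport.comp_left (g := fun t : ℝ => (t : ℂ)) (by simp)
    exact h1.mul_right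
  have hcd : ∀ m, ContDiff ℝ (⊤ : ℕ∞) (u m) := fun m =>
    (Complex.ofRealCLM.contDiff.comp (χ m).contDiff).mul (g.smooth _)
  let U : ℕ → SchwartzMap (EuclideanSpace ℝ (Fin n)) ℂ := fun m =>
    (hsupp m).toSchwartzMap (hcd m)
  have hU : ∀ m, (U m : EuclideanSpace ℝ (Fin n) → ℂ) = u m := fun m => rfl
  have hnorm : ∀ m x, ‖u m x‖ ≤ ‖g x‖ := fun m x => by
    have h0 := (χ m).nonneg (x := x)
    have h1 := (χ m).le_one (x := x)
    simp only [u, norm_mul, Complex.norm_real, Real.norm_of_nonneg h0]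
    exact mul_le_of_le_one_left (norm_nonneg _) h1
  have hdiff : ∀ m x, ‖u m x - g x‖ ≤ ‖g x‖ := fun m x => by
    have h0 := (χ m).nonneg (x := x)
    have h1 := (χ m).le_one (x := x)
    have e : u m x - g x = ((χ m x - 1 : ℝ) : ℂ) * g x := by simp only [u]; push_cast; ring
    rw [e, norm_mul, Complex.norm_real, Real.norm_eq_abs]
    refine mul_le_of_le_one_left (norm_nonneg _) ?_
    rw [abs_le]; constructor <;> linarith
  have hev : ∀ x, ∀ᶠ m in atTop, u m x = g x := fun x => by
    obtain ⟨N, hN⟩ := exists_nat_ge ‖x‖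
    filter_upwards [eventually_ge_atTop N] with m hm
    have : χ m x = 1 := (χ m).one_of_mem_closedBall (by
      simp only [mem_closedBall, dist_zero_right, χ]
      have : (N : ℝ) ≤ m := by exact_mod_cast hm
      linarith)
    simp [u, this]
  have hgi := nuc_schwartz_sq_integrable n g
  have l1 : Tendsto (fun m => ∫ x, ‖u m x‖ ^ 2) atTop (𝓝 (∫ x, ‖g x‖ ^ 2)) := by
    refine tendsto_integral_of_dominated_convergence (fun x => ‖g x‖ ^ 2)
      (fun m => ?_) hgi (fun m => Eventually.of_forall fun x => ?_)
      (Eventually.of_forall fun x => ?_)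
    · exact ((hcd m).continuous.norm.pow 2).aestronglyMeasurable
    · rw [Real.norm_of_nonneg (by positivity)]
      have := hnorm m x
      gcongr
    · refine tendsto_const_nhds.congr' ?_
      filter_upwards [hev x] with m hm
      rw [hm]
  have l2 : Tendsto (fun m => ∫ x, ‖u m x - g x‖ ^ 2) atTop (𝓝 0) := by
    have : (0 : ℝ) = ∫ x : EuclideanSpace ℝ (Fin n), (0 : ℝ) := by simp
    rw [this]
    refine tendsto_integral_of_dominated_convergence (fun x => ‖g x‖ ^ 2)
      (fun m => ?_) hgi (fun m => Eventually.of_forall fun x => ?_)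
      (Eventually.of_forall fun x => ?_)
    · exact (((hcd m).continuous.sub g.continuous).norm.pow 2).aestronglyMeasurable
    · rw [Real.norm_of_nonneg (by positivity)]
      have := hdiff m x
      gcongr
    · refine tendsto_const_nhds.congr' ?_
      filter_upwards [hev x] with m hm
      simp [hm]
  have l3 : Tendsto (fun m => C * (2 * (∫ x in S, ‖schrodingerSol n g T x‖ ^ 2) +
      2 * ∫ x, ‖u m x - g x‖ ^ 2) ^ γ * (∫ x, h x) ^ (1 - γ)) atTop
      (𝓝 (C * (2 * ∫ x in S, ‖schrodingerSol n g T x‖ ^ 2) ^ γ * (∫ x, h x) ^ (1 - γ))) := by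
    refine Tendsto.mul_const _ (Tendsto.const_mul _ ?_)
    refine Tendsto.rpow_const ?_ (Or.inr hγ.1.le)
    simpa using (l2.const_mul 2).const_add (2 * ∫ x in S, ‖schrodingerSol n g T x‖ ^ 2)
  refine le_of_tendsto_of_tendsto' l1 l3 fun m => (H (u m) ⟨hcd m, hsupp m⟩).trans ?_
  have hs := nuc_sol_split n T (U m) g S
  rw [hU] at hs
  have hγ1 : 0 ≤ 1 - γ := by linarith [hγ.2]
  have hγ0 : 0 ≤ γ := hγ.1.le
  have hn1 : 0 ≤ ∫ x in S, ‖schrodingerSol n (u m) T x‖ ^ 2 :=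
    integral_nonneg fun x => by positivity
  have hn2 : 0 ≤ ∫ x, w x * ‖u m x‖ ^ 2 :=
    integral_nonneg fun x => mul_nonneg (hw x) (by positivity)
  have hW : ∫ x, w x * ‖u m x‖ ^ 2 ≤ ∫ x, h x := by
    refine integral_mono_of_nonneg (Eventually.of_forall fun x =>
      mul_nonneg (hw x) (by positivity)) hh (Eventually.of_forall fun x => ?_)
    refine le_trans ?_ (hg x)
    have := hnorm m x
    have := hw x
    dsimp only
    gcongr
  gcongr

lemma nuc_gauss_sol (n : ℕ) (β T : ℝ) (hβ : 0 < β) (hT : 0 < T) (b : ℂ)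
    (hb : b = β + Complex.I / (4 * T))
    (g : EuclideanSpace ℝ (Fin n) → ℂ)
    (hg : ∀ x, g x = Complex.exp (-b * ((‖x‖ ^ 2 : ℝ) : ℂ)))
    (x : EuclideanSpace ℝ (Fin n)) :
    ‖schrodingerSol n g T x‖ ^ 2 =
      (1 / (4 * β * T)) ^ n * Real.exp (-(1 / (8 * β * T ^ 2)) * ‖x‖ ^ 2) := by
  have hbr : b = ⟨β, 1 / (4 * T)⟩ := by
    rw [hb]
    have : Complex.I / (4 * T) = ((1 / (4 * T) : ℝ) : ℂ) * Complex.I := by push_cast; ring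
    rw [this]
    apply Complex.ext <;> simp
  have hbre : b.re = β := by rw [hbr]
  have hbim : b.im = 1 / (4 * T) := by rw [hbr]
  have hb0 : b ≠ 0 := fun h => by rw [h] at hbre; simp at hbre; linarith
  have hTc : (T : ℂ) ≠ 0 := by exact_mod_cast hT.ne'
  have hβc : (β : ℂ) ≠ 0 := by exact_mod_cast hβ.ne'
  let B : ℂ := Complex.I * β * T / b
  have hB0 : B ≠ 0 := by simp [B, hb0, hTc, hβc]
  have hBb : B = 1 / (4 * b) + Complex.I * T := by
    simp only [B]
    field_simp
    rw [hb]
    field_simp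
    linear_combination (-1 : ℂ) * Complex.I_sq
  have hsq : 0 < Complex.normSq b := Complex.normSq_pos.mpr hb0
  have hBre : 0 < B.re := by
    have : B = (β * T : ℝ) * Complex.I / b := by simp only [B]; push_cast; ring
    rw [this, Complex.div_re]
    simp only [Complex.mul_re, Complex.mul_im, Complex.ofReal_re, Complex.ofReal_im, Complex.I_re,
      Complex.I_im, hbim]
    have : 0 < β * T * (1 / (4 * T)) / Complex.normSq b := by positivity
    simpa using this
  have hF : ∀ ξ, fourierTransformPaper n g ξ =
      (((2 * Real.pi) ^ (-(n : ℝ) / 2) : ℝ) : ℂ) * ((Real.pi / b) ^ (n / 2 : ℂ) *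
        Complex.exp (-(1 / (4 * b)) * ‖ξ‖ ^ 2)) := fun ξ => by
    rw [fourierTransformPaper]
    congr 1
    have := GaussianFourier.integral_cexp_neg_mul_sq_norm_add (b := b) (hbre ▸ hβ) (-Complex.I) ξ
    rw [finrank_euclideanSpace_fin] at this
    rw [show -(1 / (4 * b)) * (‖ξ‖ : ℂ) ^ 2 = (-Complex.I) ^ 2 * ‖ξ‖ ^ 2 / (4 * b) by
      rw [neg_sq, Complex.I_sq]; ring, ← this]
    congr 1
    ext y
    rw [hg, ← Complex.exp_add, real_inner_comm]
    congr 1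
    push_cast
    ring
  have hS : schrodingerSol n g T x = (((2 * Real.pi) ^ (-(n : ℝ) / 2) : ℝ) : ℂ) *
      ((((2 * Real.pi) ^ (-(n : ℝ) / 2) : ℝ) : ℂ) * (Real.pi / b) ^ (n / 2 : ℂ) *
      ((Real.pi / B) ^ (n / 2 : ℂ) * Complex.exp (Complex.I ^ 2 * ‖x‖ ^ 2 / (4 * B)))) := by
    have := GaussianFourier.integral_cexp_neg_mul_sq_norm_add (b := B) hBre Complex.I x
    rw [finrank_euclideanSpace_fin] at this
    rw [schrodingerSol]
    congr 1
    rw [← this, ← integral_const_mul]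
    congr 1
    ext ξ
    rw [hF, hBb]
    have : Complex.exp (-(1 / (4 * b) + Complex.I * T) * ‖ξ‖ ^ 2 + Complex.I * (⟪x, ξ⟫ : ℝ)) =
      Complex.exp (Complex.I * ((⟪x, ξ⟫ - T * ‖ξ‖ ^ 2 : ℝ) : ℂ)) *
        Complex.exp (-(1 / (4 * b)) * ‖ξ‖ ^ 2) := by
      rw [← Complex.exp_add]
      congr 1
      push_cast
      ring
    rw [this]
    ring
  have hexp : Complex.I ^ 2 * ‖x‖ ^ 2 / (4 * B) =
      ((‖x‖ ^ 2 / (4 * β * T) : ℝ) : ℂ) * (Complex.I * b) := by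
    simp only [B]
    push_cast
    field_simp
  have hre : (Complex.I ^ 2 * ‖x‖ ^ 2 / (4 * B)).re = -(1 / (16 * β * T ^ 2)) * ‖x‖ ^ 2 := by
    rw [hexp, Complex.re_ofReal_mul]
    simp only [Complex.mul_re, Complex.I_re, Complex.I_im, hbim]
    field_simp
    ring
  have hn2 : ((n : ℂ) / 2) = (((n : ℝ) / 2 : ℝ) : ℂ) := by push_cast; ring
  have hpow : ∀ y : ℝ, 0 ≤ y → (y ^ ((n : ℝ) / 2)) ^ 2 = y ^ n := fun y hy => by
    rw [← Real.rpow_natCast, ← Real.rpow_mul hy, ← Real.rpow_natCast]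
    congr 1
    push_cast
    ring
  have hc : ((2 * Real.pi) ^ (-(n : ℝ) / 2)) ^ 2 = (1 / (2 * Real.pi)) ^ n := by
    rw [← hpow _ (by positivity), neg_div, Real.rpow_neg (by positivity), one_div,
      Real.inv_rpow (by positivity)]
  have hbB : ‖(Real.pi : ℂ) / b‖ * ‖(Real.pi : ℂ) / B‖ = Real.pi ^ 2 / (β * T) := by
    rw [← norm_mul]
    have : (Real.pi : ℂ) / b * (Real.pi / B) = ((Real.pi ^ 2 / (β * T) : ℝ) : ℂ) * (-Complex.I) := by
      simp only [B]
      push_cast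
      field_simp
      rw [Complex.I_sq]; ring
    rw [this, norm_mul, Complex.norm_real, norm_neg, Complex.norm_I, mul_one,
      Real.norm_of_nonneg (by positivity)]
  rw [hS, norm_mul, norm_mul, norm_mul, norm_mul, Complex.norm_exp, hre, Complex.norm_real,
    Real.norm_of_nonneg (by positivity), hn2, Complex.norm_cpow_real, Complex.norm_cpow_real]
  have he : Real.exp (-(1 / (16 * β * T ^ 2)) * ‖x‖ ^ 2) ^ 2 =
      Real.exp (-(1 / (8 * β * T ^ 2)) * ‖x‖ ^ 2) := by
    rw [← Real.exp_nat_mul]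
    congr 1
    push_cast
    field_simp
    ring
  rw [mul_pow, mul_pow, mul_pow, mul_pow, he, hc, hpow _ (norm_nonneg _), hpow _ (norm_nonneg _)]
  have : (1 / (4 * β * T)) ^ n = (1 / (2 * Real.pi)) ^ n * ((1 / (2 * Real.pi)) ^ n *
      (‖(Real.pi : ℂ) / b‖ ^ n * ‖(Real.pi : ℂ) / B‖ ^ n)) := by
    rw [← mul_pow ‖_‖, hbB, ← mul_pow, ← mul_pow]
    congr 1
    field_simp
    ring
  rw [this]
  ring

lemma nuc_gauss_integrable (n : ℕ) {b : ℝ} (hb : 0 < b) :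
    Integrable (fun x : EuclideanSpace ℝ (Fin n) => Real.exp (-b * ‖x‖ ^ 2)) := by
  by_contra hcon
  have h1 := GaussianFourier.integral_rexp_neg_mul_sq_norm (V := EuclideanSpace ℝ (Fin n)) hb
  rw [integral_undef hcon] at h1
  have : 0 < (Real.pi / b) ^ (Module.finrank ℝ (EuclideanSpace ℝ (Fin n)) / 2 : ℝ) := by positivity
  linarith

lemma nuc_gauss_integral (n : ℕ) {b : ℝ} (hb : 0 < b) :
    ∫ x : EuclideanSpace ℝ (Fin n), Real.exp (-b * ‖x‖ ^ 2) = (Real.pi / b) ^ ((n : ℝ) / 2) := by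
  rw [GaussianFourier.integral_rexp_neg_mul_sq_norm hb, finrank_euclideanSpace_fin]

lemma nuc_mid (n : ℕ) (β T r : ℝ) (hβ : 0 < β) (hT : 0 < T) (hr : 0 < r) (b : ℂ)
    (hb : b = β + Complex.I / (4 * T))
    (g : EuclideanSpace ℝ (Fin n) → ℂ)
    (hg : ∀ x, g x = Complex.exp (-b * ((‖x‖ ^ 2 : ℝ) : ℂ))) :
    ∫ x in (closedBall (0 : EuclideanSpace ℝ (Fin n)) r)ᶜ, ‖schrodingerSol n g T x‖ ^ 2 ≤
      (Real.pi / β) ^ ((n : ℝ) / 2) * Real.exp (-(r ^ 2 / (16 * T ^ 2) * (1 / β))) := by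
  simp_rw [nuc_gauss_sol n β T hβ hT b hb g hg]
  have hp : 0 < 1 / (16 * β * T ^ 2) := by positivity
  have hi := nuc_gauss_integrable n hp
  calc _ ≤ ∫ x in (closedBall (0 : EuclideanSpace ℝ (Fin n)) r)ᶜ, ((1 / (4 * β * T)) ^ n *
          Real.exp (-(r ^ 2 / (16 * T ^ 2) * (1 / β)))) *
            Real.exp (-(1 / (16 * β * T ^ 2)) * ‖x‖ ^ 2) := by
        refine setIntegral_mono_on ?_ (hi.const_mul _).integrableOn
          isClosed_closedBall.measurableSet.compl fun x hx => ?_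
        · exact ((nuc_gauss_integrable n (by positivity)).const_mul _).integrableOn
        · rw [mul_assoc (_ ^ n), ← Real.exp_add]
          have hx' : r ≤ ‖x‖ := by
            simp only [Set.mem_compl_iff, mem_closedBall, dist_zero_right, not_le] at hx
            exact hx.le
          gcongr
          have e1 : -(1 / (8 * β * T ^ 2)) * ‖x‖ ^ 2 = -(1 / (16 * β * T ^ 2)) * ‖x‖ ^ 2 -
            (1 / (16 * β * T ^ 2)) * ‖x‖ ^ 2 := by field_simp; ring
          have e2 : -(r ^ 2 / (16 * T ^ 2) * (1 / β)) = -((1 / (16 * β * T ^ 2)) * r ^ 2) := by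
            field_simp
          have e3 : (1 / (16 * β * T ^ 2)) * r ^ 2 ≤ (1 / (16 * β * T ^ 2)) * ‖x‖ ^ 2 := by gcongr
          rw [e1, e2]
          linarith
    _ ≤ ∫ x : EuclideanSpace ℝ (Fin n), ((1 / (4 * β * T)) ^ n *
          Real.exp (-(r ^ 2 / (16 * T ^ 2) * (1 / β)))) *
            Real.exp (-(1 / (16 * β * T ^ 2)) * ‖x‖ ^ 2) :=
        setIntegral_le_integral (hi.const_mul _) (Eventually.of_forall fun x => by
          dsimp only [Pi.zero_apply]; positivity)
    _ = _ := by
        rw [integral_const_mul, nuc_gauss_integral n hp, mul_right_comm]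
        congr 1
        have h1 : (1 / (4 * β * T)) ^ n = ((1 / (4 * β * T)) ^ 2) ^ ((n : ℝ) / 2) := by
          rw [← Real.rpow_natCast, ← Real.rpow_natCast, ← Real.rpow_mul (by positivity)]
          congr 1
          push_cast
          ring
        rw [h1, ← Real.mul_rpow (by positivity) (by positivity)]
        congr 1
        field_simp
        ring

lemma nuc_alpha (α : ℝ → ℝ) (hαpos : ∀ s, 0 < s → 0 < α s) (hαmono : MonotoneOn α (Set.Ioi 0))
    (hαlim : Tendsto (fun s => α s / s) atTop (𝓝 0)) {ε : ℝ} (hε : 0 < ε) :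
    ∃ M, ∀ s, 0 ≤ s → α s ≤ ε * s + M := by
  have h1 := (hαlim.eventually (gt_mem_nhds hε)).and (eventually_gt_atTop 0)
  obtain ⟨s₀, hs₀⟩ := eventually_atTop.1 h1
  have hp := (hs₀ s₀ le_rfl).2
  refine ⟨max (α s₀) (α 0), fun s hs => ?_⟩
  have hM := hαpos s₀ hp
  have hM1 := le_max_left (α s₀) (α 0)
  have hM2 := le_max_right (α s₀) (α 0)
  have hes : 0 ≤ ε * s := by positivity
  rcases hs.eq_or_lt with rfl | hs'
  · linarith
  · rcases le_total s s₀ with h | h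
    · have := hαmono hs' hp h
      linarith
    · have := (hs₀ s h).1
      rw [div_lt_iff₀ hs'] at this
      linarith

end


/-- Theorem 1.2 (iii): if `α : (0,∞) → (0,∞)` is increasing with `α(s)/s → 0` as `s → ∞`,
then for all `r, a, T > 0` and `γ ∈ (0,1)` there is no `C > 0` such that
`∫|u₀|² ≤ C (∫_{B_r(0)ᶜ}|u(·,T;u₀)|²)^γ (∫ e^{a α(|x|)}|u₀|²)^{1-γ}` for all
`u₀ ∈ C₀^∞(ℝⁿ;ℂ)`. -/
theorem no_unique_continuation_sublinear_weight (n : ℕ) (hn : 1 ≤ n)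
    (α : ℝ → ℝ) (hαpos : ∀ s, 0 < s → 0 < α s) (hαmono : MonotoneOn α (Set.Ioi 0))
    (hαlim : Tendsto (fun s => α s / s) atTop (𝓝 0))
    (r a T : ℝ) (hr : 0 < r) (ha : 0 < a) (hT : 0 < T)
    (γ : ℝ) (hγ : γ ∈ Set.Ioo (0 : ℝ) 1) :
    ¬ ∃ C > (0 : ℝ),
        ∀ u₀ : EuclideanSpace ℝ (Fin n) → ℂ, IsTestFun n u₀ →
          (∫ x, ‖u₀ x‖ ^ 2) ≤
            C * (∫ x in (closedBall (0 : EuclideanSpace ℝ (Fin n)) r)ᶜ,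
                    ‖schrodingerSol n u₀ T x‖ ^ 2) ^ γ *
              (∫ x, Real.exp (a * α ‖x‖) * ‖u₀ x‖ ^ 2) ^ (1 - γ) := by
  rintro ⟨C, hC, H⟩
  have hγ0 := hγ.1
  have hγ1 := hγ.2
  set ε : ℝ := r * √(γ / 8) / (a * T) with hεdef
  have hε : 0 < ε := by positivity
  have hε2 : ε ^ 2 * a ^ 2 / 4 = γ * r ^ 2 / (32 * T ^ 2) := by
    rw [hεdef, div_pow, mul_pow, Real.sq_sqrt (by positivity)]
    field_simp
    ring
  obtain ⟨M, hM⟩ := nuc_alpha α hαpos hαmono hαlim hε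
  -- the main inequality for Gaussians
  have main : ∀ β : ℝ, 0 < β → (1 / 2 : ℝ) ^ ((n : ℝ) / 2) ≤
      C * 2 ^ γ * Real.exp ((1 - γ) * (a * M)) *
        Real.exp (-(γ * r ^ 2 / (32 * T ^ 2)) * (1 / β)) := by
    intro β hβ
    set b : ℂ := β + Complex.I / (4 * T) with hb
    have hbre : b.re = β := by
      have : Complex.I / (4 * T) = ((1 / (4 * T) : ℝ) : ℂ) * Complex.I := by push_cast; ring
      rw [hb, this]
      simp
    obtain ⟨g, hg⟩ := nuc_gauss_schwartz n b (hbre ▸ hβ)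
    have hgn : ∀ x, ‖g x‖ ^ 2 = Real.exp (-(2 * β) * ‖x‖ ^ 2) := fun x => by
      rw [hg, Complex.norm_exp, ← Real.exp_nat_mul]
      congr 1
      rw [Complex.re_mul_ofReal, Complex.neg_re, hbre]
      push_cast
      ring
    set Y : ℝ := a * M + ε ^ 2 * a ^ 2 / 4 * (1 / β) with hY
    set P : ℝ := (Real.pi / β) ^ ((n : ℝ) / 2) with hP
    have hPpos : 0 < P := by positivity
    have h1 := nuc_limit n T C γ hC hγ (closedBall (0 : EuclideanSpace ℝ (Fin n)) r)ᶜ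
      (fun x => Real.exp (a * α ‖x‖)) (fun x => Real.exp Y * Real.exp (-β * ‖x‖ ^ 2))
      (fun x => by positivity) ((nuc_gauss_integrable n hβ).const_mul _) H g (fun x => by
        rw [hgn, ← Real.exp_add, ← Real.exp_add]
        refine Real.exp_le_exp.mpr ?_
        have h2 := mul_le_mul_of_nonneg_left (hM ‖x‖ (norm_nonneg _)) ha.le
        have h3 : 0 ≤ (ε * a - 2 * β * ‖x‖) ^ 2 / (4 * β) := by positivity
        have h4 : (ε * a - 2 * β * ‖x‖) ^ 2 / (4 * β) =
          ε ^ 2 * a ^ 2 / 4 * (1 / β) - a * ε * ‖x‖ + β * ‖x‖ ^ 2 := by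
          field_simp
          ring
        rw [hY]
        nlinarith)
    simp_rw [hgn] at h1
    rw [nuc_gauss_integral n (by positivity), integral_const_mul, nuc_gauss_integral n hβ,
      ← hP] at h1
    have hmid := nuc_mid n β T r hβ hT hr b hb g hg
    rw [← hP] at hmid
    set X : ℝ := r ^ 2 / (16 * T ^ 2) * (1 / β) with hX
    have hn1 : 0 ≤ ∫ x in (closedBall (0 : EuclideanSpace ℝ (Fin n)) r)ᶜ,
      ‖schrodingerSol n g T x‖ ^ 2 := integral_nonneg fun x => by positivity
    have h2 : (Real.pi / (2 * β)) ^ ((n : ℝ) / 2) ≤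
        C * (2 * (P * Real.exp (-X))) ^ γ * (Real.exp Y * P) ^ (1 - γ) := by
      refine h1.trans ?_
      gcongr
    have h3 : (Real.pi / (2 * β)) ^ ((n : ℝ) / 2) = (1 / 2 : ℝ) ^ ((n : ℝ) / 2) * P := by
      rw [hP, ← Real.mul_rpow (by positivity) (by positivity)]
      congr 1
      field_simp
    have h4 : C * (2 * (P * Real.exp (-X))) ^ γ * (Real.exp Y * P) ^ (1 - γ) =
        C * 2 ^ γ * (Real.exp (-X * γ + Y * (1 - γ))) * P := by
      rw [Real.mul_rpow (by positivity) (by positivity), Real.mul_rpow (by positivity)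
        (by positivity), Real.mul_rpow (by positivity) (by positivity), ← Real.exp_mul,
        ← Real.exp_mul, Real.exp_add]
      have : P ^ γ * P ^ (1 - γ) = P := by
        rw [← Real.rpow_add hPpos]; simp
      linear_combination (C * 2 ^ γ * Real.exp (-X * γ) * Real.exp (Y * (1 - γ))) * this
    rw [h3, h4] at h2
    have h5 := le_of_mul_le_mul_right h2 hPpos
    refine h5.trans ?_
    rw [mul_assoc _ (Real.exp _) (Real.exp _), ← Real.exp_add]
    refine mul_le_mul_of_nonneg_left (Real.exp_le_exp.mpr ?_) (by positivity)
    rw [hY, hε2, hX]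
    have e : r ^ 2 / (16 * T ^ 2) * (1 / β) * γ = 2 * (γ * r ^ 2 / (32 * T ^ 2) * (1 / β)) := by
      field_simp
      ring
    have e2 : 0 ≤ γ * r ^ 2 / (32 * T ^ 2) * (1 / β) := by positivity
    nlinarith
  have hD : 0 < γ * r ^ 2 / (32 * T ^ 2) := by positivity
  have lim : Tendsto (fun k : ℝ => C * 2 ^ γ * Real.exp ((1 - γ) * (a * M)) *
        Real.exp (-(γ * r ^ 2 / (32 * T ^ 2)) * k)) atTop (𝓝 0) := by
    have : Tendsto (fun k : ℝ => Real.exp (-(γ * r ^ 2 / (32 * T ^ 2)) * k)) atTop (𝓝 0) :=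
      Real.tendsto_exp_atBot.comp (tendsto_id.const_mul_atTop_of_neg (by linarith))
    simpa using this.const_mul (C * 2 ^ γ * Real.exp ((1 - γ) * (a * M)))
  have hle : (1 / 2 : ℝ) ^ ((n : ℝ) / 2) ≤ 0 := by
    refine ge_of_tendsto lim ?_
    filter_upwards [eventually_gt_atTop 0] with k hk
    simpa using main k⁻¹ (by positivity)
  have : 0 < (1 / 2 : ℝ) ^ ((n : ℝ) / 2) := by positivity
  linarith
end

section
/- There exist constants C > 0 and θ ∈ (0,1), both depending only on n, such that for all x', x'' ∈ ℝⁿ, all r₁, r₂ > 0, a > 0, T > 0, and every u₀ ∈ C₀^∞(ℝⁿ;ℂ): setting p = 1 + (|x'−x''| + r₁ + r₂)/((aT) ∧ r₁), one has ∫_{B_{r₂}(x'')} |u(x,T;u₀)|² dx ≤ C r₂ⁿ ((aT) ∧ r₁)^{−n} · ( ∫_{B_{r₁}(x')} |u(x,T;u₀)|² dx )^{θ^p} · ( ∫_{ℝⁿ} e^{a|x|} |u₀(x)|² dx )^{1−θ^p}. -/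
open MeasureTheory Filter Metric
open scoped Real RealInnerProductSpace ENNReal Topology

theorem ucb_step (h : ℂ → ℂ) (hd : Differentiable ℂ h) (K q : ℝ) (hK : 0 < K) (hq0 : 0 ≤ q)
    (hq1 : q ≤ 1) (hb : ∀ z : ℂ, |z.im| ≤ 1 / 2 → ‖h z‖ ≤ K) (s : ℝ)
    (hs : ∀ t : ℝ, s - 1 / 4 ≤ t → t ≤ s + 1 / 4 → ‖h t‖ ≤ K * q) (t : ℝ)
    (ht1 : s - 1 / 4 ≤ t) (ht2 : t ≤ s + 1 / 4 + 1 / 32) : ‖h t‖ ≤ K * q ^ (1 / 2 : ℝ) := by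
  by_cases htt : t ≤ s + 1 / 4
  · refine (hs t ht1 htt).trans ?_
    have : q ≤ q ^ (1 / 2 : ℝ) := by
      have := Real.rpow_le_rpow_of_exponent_ge' hq0 hq1 (by norm_num) (by norm_num : (1/2 : ℝ) ≤ 1)
      simpa using this
    gcongr
  push Not at htt
  set y : ℝ := 4 * (t - s) with hy
  have hy1 : 1 ≤ y := by linarith
  have hy2 : y ≤ 9 / 8 := by linarith
  set v := Real.arcosh y with hv
  have hcv : Real.cosh v = y := Real.cosh_arcosh hy1
  have hv0 : 0 ≤ v := Real.arcosh_nonneg hy1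
  have hch : 9 / 8 ≤ Real.cosh (1 / 2) := by
    have h1 : Real.cosh (1 / 2) = Real.cosh (2 * (1 / 4)) := by norm_num
    rw [h1, Real.cosh_two_mul, Real.cosh_sq]
    have : (1 / 4 : ℝ) ≤ Real.sinh (1 / 4) := Real.self_le_sinh_iff.2 (by norm_num)
    nlinarith
  have hv1 : v ≤ 1 / 2 := by
    have : Real.cosh v ≤ Real.cosh (1 / 2) := by rw [hcv]; linarith
    rw [Real.cosh_le_cosh, abs_of_nonneg hv0, abs_of_nonneg (by norm_num)] at this
    exact this
  have hsinh : Real.sinh 1 ≤ 2 := by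
    rw [Real.sinh_eq]
    have := Real.exp_one_lt_d9
    have := Real.exp_pos (-1)
    linarith
  let f : ℂ → ℂ := fun w => h (s + (1 / 4 : ℝ) * Complex.cosh w)
  have hfd : Differentiable ℂ f := by
    apply hd.comp
    exact (Complex.differentiable_cosh.const_mul _).const_add _
  have him : ∀ w : ℂ, 0 ≤ w.re → w.re ≤ 1 → ‖f w‖ ≤ K := by
    intro w h0 h1
    apply hb
    have : ((s : ℂ) + (1 / 4 : ℝ) * Complex.cosh w).im = 1 / 4 * (Real.sinh w.re * Real.sin w.im) := by
      rw [← Complex.re_add_im w, Complex.cosh_add, Complex.cosh_mul_I, Complex.sinh_mul_I]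
      simp only [← Complex.ofReal_cosh, ← Complex.ofReal_sinh, ← Complex.ofReal_cos, ← Complex.ofReal_sin]
      simp [Complex.sinh_ofReal_re, Complex.sin_ofReal_re]
    rw [this, abs_mul, abs_mul]
    have a1 : |Real.sinh w.re| ≤ 2 := by
      rw [abs_of_nonneg (Real.sinh_nonneg_iff.2 h0)]
      exact (Real.sinh_le_sinh.2 h1).trans hsinh
    have a2 := Real.abs_sin_le_one w.im
    rw [abs_of_nonneg (by norm_num : (0:ℝ) ≤ 1/4)]
    nlinarith [abs_nonneg (Real.sinh w.re), abs_nonneg (Real.sin w.im)]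
  have key := Complex.HadamardThreeLines.norm_le_interp_of_mem_verticalClosedStrip' (f := f)
    (z := (v : ℂ)) (a := K * q) (b := K) (l := 0) (u := 1) one_pos
    (by simp [Complex.HadamardThreeLines.verticalClosedStrip]; constructor <;> linarith)
    hfd.diffContOnCl
    (by
      refine ⟨K, ?_⟩
      rintro _ ⟨w, hw, rfl⟩
      simp only [Complex.HadamardThreeLines.verticalClosedStrip, Set.mem_preimage, Set.mem_Icc] at hw
      exact him w hw.1 hw.2)
    (by
      intro w hw
      simp only [Set.mem_preimage, Set.mem_singleton_iff] at hw
      have e : w = (w.im : ℂ) * Complex.I := by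
        conv_lhs => rw [← Complex.re_add_im w, hw]
        simp
      have : f w = h ((s + 1 / 4 * Real.cos w.im : ℝ) : ℂ) := by
        simp only [f]
        conv_lhs => rw [e, Complex.cosh_mul_I]
        push_cast
        rfl
      rw [this]
      apply hs <;> nlinarith [Real.cos_le_one w.im, Real.neg_one_le_cos w.im])
    (by
      intro w hw
      simp only [Set.mem_preimage, Set.mem_singleton_iff] at hw
      exact him w (by rw [hw]; norm_num) hw.le)
  have e : f v = h t := by
    simp only [f]
    rw [← Complex.ofReal_cosh, hcv, hy]
    congr 1
    push_cast
    ring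
  rw [e] at key
  refine key.trans ?_
  simp only [Complex.ofReal_re, sub_zero, div_one]
  rw [Real.mul_rpow hK.le hq0]
  have : K ^ (1 - v) * q ^ (1 - v) * K ^ v = K * q ^ (1 - v) := by
    rw [mul_right_comm, ← Real.rpow_add hK]; simp
  rw [this]
  have := Real.rpow_le_rpow_of_exponent_ge' hq0 hq1 (by norm_num) (by linarith : (1/2 : ℝ) ≤ 1 - v)
  gcongr

theorem ucb_iter (h : ℂ → ℂ) (hd : Differentiable ℂ h) (K q : ℝ) (hK : 0 < K) (hq0 : 0 ≤ q)
    (hq1 : q ≤ 1) (hb : ∀ z : ℂ, |z.im| ≤ 1 / 2 → ‖h z‖ ≤ K)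
    (hs : ∀ t : ℝ, 0 ≤ t → t ≤ 1 / 2 → ‖h t‖ ≤ K * q) (k : ℕ) :
    ∀ t : ℝ, 0 ≤ t → t ≤ 1 / 2 + k / 32 → ‖h t‖ ≤ K * q ^ ((1 / 2 : ℝ) ^ k) := by
  induction k with
  | zero => simpa using hs
  | succ k ih =>
    intro t h0 h1
    push_cast at h1
    rw [pow_succ, Real.rpow_mul hq0]
    have hk : (0:ℝ) ≤ k := by positivity
    by_cases htt : t ≤ 1 / 4
    · refine ucb_step h hd K _ hK (by positivity) (Real.rpow_le_one hq0 hq1 (by positivity)) hb (1/4)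
        (fun t h1 h2 => ih t (by linarith) (by linarith)) t (by linarith) (by linarith)
    · obtain ⟨m, hm⟩ : ∃ m : ℝ, m = min ((k : ℝ) / 32) (t - 1 / 4) := ⟨_, rfl⟩
      have m0 : 0 ≤ m := by rw [hm]; exact le_min (by positivity) (by linarith)
      have m1 : m ≤ (k : ℝ) / 32 := by rw [hm]; exact min_le_left _ _
      have m2 : m ≤ t - 1 / 4 := by rw [hm]; exact min_le_right _ _
      have m3 : t ≤ 1 / 4 + m + 1 / 4 + 1 / 32 := by
        rcases min_choice ((k:ℝ)/32) (t - 1/4) with h | h <;> rw [hm, h] <;> linarith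
      exact ucb_step h hd K _ hK (by positivity) (Real.rpow_le_one hq0 hq1 (by positivity)) hb
        (1 / 4 + m) (fun u h1 h2 => ih u (by linarith) (by linarith)) t (by linarith) m3

theorem ucb_ft_eq (n : ℕ) (f : EuclideanSpace ℝ (Fin n) → ℂ) (ξ : EuclideanSpace ℝ (Fin n)) :
    fourierTransformPaper n f ξ = (((2 * Real.pi) ^ (-(n : ℝ) / 2) : ℝ) : ℂ) *
      FourierTransform.fourier f ((2 * Real.pi)⁻¹ • ξ) := by
  unfold fourierTransformPaper
  congr 1
  rw [Real.fourier_eq']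
  congr 1
  ext y
  rw [smul_eq_mul]
  congr 2
  rw [real_inner_smul_right]
  have : (π : ℂ) ≠ 0 := by exact_mod_cast Real.pi_ne_zero
  push_cast
  field_simp

theorem ucb_ft_integrable (n : ℕ) (f : EuclideanSpace ℝ (Fin n) → ℂ) (hf : IsTestFun n f) :
    Integrable (fourierTransformPaper n f) := by
  have h1 : fourierTransformPaper n f = fun ξ => (((2 * Real.pi) ^ (-(n : ℝ) / 2) : ℝ) : ℂ) *
      FourierTransform.fourier f ((2 * Real.pi)⁻¹ • ξ) := funext (ucb_ft_eq n f)
  rw [h1]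
  apply Integrable.const_mul
  have : Integrable (FourierTransform.fourier f) := by
    have := (FourierTransform.fourier (hf.2.toSchwartzMap hf.1)).integrable (μ := volume)
    rw [SchwartzMap.fourier_coe] at this
    exact this
  exact this.comp_smul (by positivity)

theorem ucb_test_int (n : ℕ) (f : EuclideanSpace ℝ (Fin n) → ℂ) (hf : IsTestFun n f) :
    Integrable f := hf.1.continuous.integrable_of_hasCompactSupport hf.2

theorem ucb_gauss (n : ℕ) (f : EuclideanSpace ℝ (Fin n) → ℂ) (hf : IsTestFun n f) (b : ℂ)
    (hb : 0 < b.re) (x : EuclideanSpace ℝ (Fin n)) :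
    ∫ ξ : EuclideanSpace ℝ (Fin n), Complex.exp (-b * ‖ξ‖ ^ 2 + Complex.I * (⟪x, ξ⟫ : ℝ)) *
      fourierTransformPaper n f ξ = (((2 * Real.pi) ^ (-(n : ℝ) / 2) : ℝ) : ℂ) *
      ((π / b) ^ (((n : ℝ) / 2 : ℝ) : ℂ) *
        ∫ y : EuclideanSpace ℝ (Fin n), Complex.exp (-‖x - y‖ ^ 2 / (4 * b)) * f y) := by
  unfold fourierTransformPaper
  have e1 : ∀ ξ : EuclideanSpace ℝ (Fin n),
      Complex.exp (-b * ‖ξ‖ ^ 2 + Complex.I * (⟪x, ξ⟫ : ℝ)) *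
      ((((2 * Real.pi) ^ (-(n : ℝ) / 2) : ℝ) : ℂ) *
        ∫ y : EuclideanSpace ℝ (Fin n), Complex.exp (-Complex.I * (⟪y, ξ⟫ : ℝ)) * f y) =
      (((2 * Real.pi) ^ (-(n : ℝ) / 2) : ℝ) : ℂ) * ∫ y : EuclideanSpace ℝ (Fin n),
        Complex.exp (-b * ‖ξ‖ ^ 2 + Complex.I * (⟪x - y, ξ⟫ : ℝ)) * f y := by
    intro ξ
    rw [mul_left_comm, ← integral_const_mul]
    congr 2
    ext y
    rw [← mul_assoc, ← Complex.exp_add, inner_sub_left]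
    congr 2
    push_cast
    ring
  simp_rw [e1]
  rw [integral_const_mul]
  congr 1
  rw [integral_integral_swap]
  · rw [← integral_const_mul]
    congr 1
    ext y
    rw [integral_mul_const]
    have := GaussianFourier.integral_cexp_neg_mul_sq_norm_add hb Complex.I (x - y)
    rw [this]
    simp [finrank_euclideanSpace]
    ring
  · have hg : Integrable (fun v : EuclideanSpace ℝ (Fin n) => Complex.exp (-b * ‖v‖ ^ 2)) := by
      simpa using GaussianFourier.integrable_cexp_neg_mul_sq_norm_add hb 0 (0 : EuclideanSpace ℝ (Fin n))
    have hp := (hg.mul_prod (ucb_test_int n f hf))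
    refine hp.mono ?_ ?_
    · apply Continuous.aestronglyMeasurable
      have := hf.1.continuous
      fun_prop
    · refine Eventually.of_forall fun p => le_of_eq ?_
      simp only [Function.uncurry, norm_mul, Complex.exp_add]
      rw [mul_comm Complex.I, Complex.norm_exp_ofReal_mul_I, mul_one]

theorem ucb_formula (n : ℕ) (f : EuclideanSpace ℝ (Fin n) → ℂ) (hf : IsTestFun n f) (T : ℝ)
    (hT : 0 < T) (x : EuclideanSpace ℝ (Fin n)) :
    ∫ ξ : EuclideanSpace ℝ (Fin n), Complex.exp (-(Complex.I * T) * ‖ξ‖ ^ 2 + Complex.I * (⟪x, ξ⟫ : ℝ)) *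
      fourierTransformPaper n f ξ = (((2 * Real.pi) ^ (-(n : ℝ) / 2) : ℝ) : ℂ) *
      ((π / (Complex.I * T)) ^ (((n : ℝ) / 2 : ℝ) : ℂ) *
        ∫ y : EuclideanSpace ℝ (Fin n), Complex.exp (-‖x - y‖ ^ 2 / (4 * (Complex.I * T))) * f y) := by
  have hTne : (T : ℂ) ≠ 0 := by exact_mod_cast hT.ne'
  have hITne : Complex.I * (T : ℂ) ≠ 0 := mul_ne_zero Complex.I_ne_zero hTne
  let b : ℝ → ℂ := fun ε => ε + Complex.I * T
  have hbc : Continuous b := by fun_prop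
  have hb0 : b 0 = Complex.I * T := by simp [b]
  have hbt : Tendsto b (𝓝[>] 0) (𝓝 (Complex.I * T)) := by
    rw [← hb0]; exact hbc.continuousAt.tendsto.mono_left nhdsWithin_le_nhds
  have hbre : ∀ ε, (b ε).re = ε := by intro ε; simp [b]
  have hcf : Continuous f := hf.1.continuous
  have hcI := ucb_ft_integrable n f hf
  have L : Tendsto (fun ε : ℝ => ∫ ξ : EuclideanSpace ℝ (Fin n),
      Complex.exp (-(b ε) * ‖ξ‖ ^ 2 + Complex.I * (⟪x, ξ⟫ : ℝ)) * fourierTransformPaper n f ξ) (𝓝[>] 0)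
      (𝓝 (∫ ξ : EuclideanSpace ℝ (Fin n), Complex.exp (-(Complex.I * T) * ‖ξ‖ ^ 2 +
        Complex.I * (⟪x, ξ⟫ : ℝ)) * fourierTransformPaper n f ξ)) := by
    refine tendsto_integral_filter_of_dominated_convergence (fun ξ => ‖fourierTransformPaper n f ξ‖)
      ?_ ?_ hcI.norm ?_
    · refine Eventually.of_forall fun ε => ?_
      refine AEStronglyMeasurable.mul ?_ hcI.aestronglyMeasurable
      apply Continuous.aestronglyMeasurable
      fun_prop
    · filter_upwards [self_mem_nhdsWithin] with ε hε
      refine Eventually.of_forall fun ξ => ?_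
      rw [norm_mul]
      have : ‖Complex.exp (-(b ε) * ‖ξ‖ ^ 2 + Complex.I * (⟪x, ξ⟫ : ℝ))‖ ≤ 1 := by
        rw [Complex.norm_exp, Real.exp_le_one_iff]
        have : (-(b ε) * ‖ξ‖ ^ 2 + Complex.I * (⟪x, ξ⟫ : ℝ)).re = - ε * ‖ξ‖ ^ 2 := by
          rw [← Complex.ofReal_pow, Complex.add_re, Complex.re_mul_ofReal, Complex.neg_re, hbre]
          simp only [Complex.I_mul_re, Complex.ofReal_im, neg_zero, add_zero]
        rw [this]
        have : 0 < ε := hε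
        have : 0 ≤ ε * ‖ξ‖ ^ 2 := by positivity
        linarith
      exact mul_le_of_le_one_left (norm_nonneg _) this
    · refine Eventually.of_forall fun ξ => ?_
      refine Tendsto.mul_const _ ?_
      refine (Complex.continuous_exp.tendsto _).comp ?_
      exact (hbt.neg.mul_const _).add_const _
  have hbne : ∀ᶠ ε in 𝓝[>] (0:ℝ), b ε ≠ 0 := hbt.eventually_ne hITne
  have R1 : Tendsto (fun ε : ℝ => ∫ y : EuclideanSpace ℝ (Fin n),
      Complex.exp (-‖x - y‖ ^ 2 / (4 * b ε)) * f y) (𝓝[>] 0)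
      (𝓝 (∫ y : EuclideanSpace ℝ (Fin n),
        Complex.exp (-‖x - y‖ ^ 2 / (4 * (Complex.I * T))) * f y)) := by
    refine tendsto_integral_filter_of_dominated_convergence (fun y => ‖f y‖)
      ?_ ?_ (ucb_test_int n f hf).norm ?_
    · refine Eventually.of_forall fun ε => ?_
      apply Continuous.aestronglyMeasurable
      fun_prop
    · filter_upwards [self_mem_nhdsWithin] with ε hε
      refine Eventually.of_forall fun y => ?_
      rw [norm_mul]
      have : ‖Complex.exp (-‖x - y‖ ^ 2 / (4 * b ε))‖ ≤ 1 := by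
        rw [Complex.norm_exp, Real.exp_le_one_iff]
        have e : (-(‖x - y‖ : ℂ) ^ 2 / (4 * b ε)) = ((-(‖x - y‖ ^ 2 / 4) : ℝ) : ℂ) * (b ε)⁻¹ := by
          push_cast
          rw [mul_comm (4:ℂ), ← div_div, div_eq_mul_inv, div_eq_mul_inv]
          ring
        rw [e, Complex.re_ofReal_mul, Complex.inv_re, hbre]
        have : 0 < ε := hε
        have : 0 ≤ (‖x - y‖ ^ 2 / 4) * (ε / Complex.normSq (b ε)) := by
          have := Complex.normSq_nonneg (b ε)
          positivity
        linarith
      exact mul_le_of_le_one_left (norm_nonneg _) this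
    · refine Eventually.of_forall fun y => ?_
      refine Tendsto.mul_const _ ?_
      refine (Complex.continuous_exp.tendsto _).comp ?_
      refine Tendsto.div tendsto_const_nhds (hbt.const_mul _) (mul_ne_zero (by norm_num) hITne)
  have R2 : Tendsto (fun ε : ℝ => ((π : ℂ) / b ε) ^ (((n : ℝ) / 2 : ℝ) : ℂ)) (𝓝[>] 0)
      (𝓝 (((π : ℂ) / (Complex.I * T)) ^ (((n : ℝ) / 2 : ℝ) : ℂ))) := by
    refine Tendsto.cpow (tendsto_const_nhds.div hbt hITne) tendsto_const_nhds ?_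
    right
    have : (π : ℂ) / (Complex.I * T) = ((- (π / T) : ℝ) : ℂ) * Complex.I := by
      push_cast
      field_simp
      simp
    rw [this]
    simp [Real.pi_ne_zero, hT.ne']
  have R := (R2.mul R1).const_mul (((2 * Real.pi) ^ (-(n : ℝ) / 2) : ℝ) : ℂ)
  refine tendsto_nhds_unique L (R.congr' ?_)
  filter_upwards [self_mem_nhdsWithin] with ε hε
  exact (ucb_gauss n f hf (b ε) (by rw [hbre]; exact hε) x).symm

theorem ucb_sol_norm (n : ℕ) (f : EuclideanSpace ℝ (Fin n) → ℂ) (hf : IsTestFun n f) (T : ℝ)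
    (hT : 0 < T) (x : EuclideanSpace ℝ (Fin n)) :
    ‖schrodingerSol n f T x‖ = (4 * π * T) ^ (-(n : ℝ) / 2) *
      ‖∫ y : EuclideanSpace ℝ (Fin n), Complex.exp (-Complex.I * ((⟪x, y⟫ / (2 * T) : ℝ) : ℂ)) *
        (Complex.exp (Complex.I * ((‖y‖ ^ 2 / (4 * T) : ℝ) : ℂ)) * f y)‖ := by
  have hTne : (T : ℂ) ≠ 0 := by exact_mod_cast hT.ne'
  have e0 : schrodingerSol n f T x = (((2 * Real.pi) ^ (-(n : ℝ) / 2) : ℝ) : ℂ) *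
      ∫ ξ : EuclideanSpace ℝ (Fin n), Complex.exp (-(Complex.I * T) * ‖ξ‖ ^ 2 + Complex.I * (⟪x, ξ⟫ : ℝ)) *
      fourierTransformPaper n f ξ := by
    unfold schrodingerSol
    congr 2
    ext ξ
    congr 2
    push_cast
    ring
  have e1 : ∫ y : EuclideanSpace ℝ (Fin n), Complex.exp (-‖x - y‖ ^ 2 / (4 * (Complex.I * T))) * f y =
      Complex.exp (((‖x‖ ^ 2 / (4 * T) : ℝ) : ℂ) * Complex.I) *
      ∫ y : EuclideanSpace ℝ (Fin n), Complex.exp (-Complex.I * ((⟪x, y⟫ / (2 * T) : ℝ) : ℂ)) *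
        (Complex.exp (Complex.I * ((‖y‖ ^ 2 / (4 * T) : ℝ) : ℂ)) * f y) := by
    rw [← integral_const_mul]
    congr 1
    ext y
    simp only [← mul_assoc, ← Complex.exp_add]
    congr 2
    rw [← Complex.ofReal_pow, norm_sub_sq_real]
    have hI : Complex.I ≠ 0 := Complex.I_ne_zero
    push_cast
    field_simp
    ring_nf
    simp only [Complex.I_sq]
    ring
  rw [e0, ucb_formula n f hf T hT x, e1]
  simp only [norm_mul, Complex.norm_exp_ofReal_mul_I, Complex.norm_real, one_mul]
  rw [Complex.norm_cpow_real]
  simp only [norm_div, norm_mul, Complex.norm_I, Complex.norm_real, one_mul]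
  rw [← mul_assoc, ← mul_assoc]
  congr 1
  rw [Real.norm_of_nonneg (by positivity), Real.norm_of_nonneg Real.pi_pos.le, Real.norm_of_nonneg hT.le]
  rw [← Real.mul_rpow (by positivity) (by positivity)]
  have : (π / T) ^ ((n : ℝ) / 2) = (T / π) ^ (-(n : ℝ) / 2) := by
    rw [neg_div, Real.rpow_neg (by positivity), ← Real.inv_rpow (by positivity), inv_div]
  rw [this, ← Real.mul_rpow (by positivity) (by positivity)]
  congr 1
  field_simp
  ring

theorem ucb_diff (n : ℕ) (g : EuclideanSpace ℝ (Fin n) → ℂ) (hg : Continuous g)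
    (hgs : HasCompactSupport g) (p q : EuclideanSpace ℝ (Fin n) → ℝ) (hp : Continuous p)
    (hq : Continuous q) :
    Differentiable ℂ (fun s : ℂ => ∫ y : EuclideanSpace ℝ (Fin n),
      Complex.exp (-Complex.I * ((p y : ℂ) + s * (q y : ℂ))) * g y) := by
  intro s₀
  have key := hasDerivAt_integral_of_dominated_loc_of_deriv_le (𝕜 := ℂ) (μ := volume) (x₀ := s₀)
    (s := ball s₀ 1)
    (F := fun s (y : EuclideanSpace ℝ (Fin n)) =>
      Complex.exp (-Complex.I * ((p y : ℂ) + s * (q y : ℂ))) * g y)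
    (F' := fun s y => Complex.exp (-Complex.I * ((p y : ℂ) + s * (q y : ℂ))) *
      (-Complex.I * (q y : ℂ)) * g y)
    (bound := fun y => Real.exp ((‖s₀‖ + 1) * |q y|) * |q y| * ‖g y‖)
    (ball_mem_nhds _ one_pos) ?_ ?_ ?_ ?_ ?_ ?_
  · exact key.2.differentiableAt
  · refine Eventually.of_forall fun s => Continuous.aestronglyMeasurable (by fun_prop)
  · refine Continuous.integrable_of_hasCompactSupport (by fun_prop) hgs.mul_left
  · exact Continuous.aestronglyMeasurable (by fun_prop)
  · refine Eventually.of_forall fun y s hs => ?_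
    simp only [norm_mul, norm_neg, Complex.norm_I, one_mul, Complex.norm_real, Real.norm_eq_abs]
    have h1 : ‖s‖ ≤ ‖s₀‖ + 1 := by
      have : ‖s - s₀‖ < 1 := by simpa [dist_eq_norm] using hs
      have := norm_sub_norm_le s s₀
      linarith
    have : ‖Complex.exp (-Complex.I * ((p y : ℂ) + s * (q y : ℂ)))‖ ≤
        Real.exp ((‖s₀‖ + 1) * |q y|) := by
      rw [Complex.norm_exp, Real.exp_le_exp]
      have e : (-Complex.I * ((p y : ℂ) + s * (q y : ℂ))).re = s.im * q y := by simp
      rw [e]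
      calc s.im * q y ≤ |s.im * q y| := le_abs_self _
        _ = |s.im| * |q y| := abs_mul _ _
        _ ≤ (‖s₀‖ + 1) * |q y| := by
            gcongr
            exact (Complex.abs_im_le_norm s).trans h1
    gcongr
  · refine Continuous.integrable_of_hasCompactSupport (by fun_prop) hgs.norm.mul_left
  · refine Eventually.of_forall fun y s hs => ?_
    have h1 : HasDerivAt (fun s : ℂ => -Complex.I * ((p y : ℂ) + s * (q y : ℂ)))
        (-Complex.I * (q y : ℂ)) s := by
      have := (((hasDerivAt_id s).mul_const (q y : ℂ)).const_add (p y : ℂ)).const_mul (-Complex.I)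
      simpa using this
    exact h1.cexp.mul_const _

theorem ucb_bound (n : ℕ) (g : EuclideanSpace ℝ (Fin n) → ℂ) (hg : Continuous g)
    (hgs : HasCompactSupport g) (x e : EuclideanSpace ℝ (Fin n)) (a T : ℝ) (ha : 0 < a)
    (hT : 0 < T) (z : ℂ) (hz : |z.im| * ‖e‖ ≤ a * T / 2) :
    ‖∫ y : EuclideanSpace ℝ (Fin n),
      Complex.exp (-Complex.I * (((⟪x, y⟫ / (2 * T) : ℝ) : ℂ) +
        z * ((⟪e, y⟫ / (2 * T) : ℝ) : ℂ))) * g y‖ ≤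
      ∫ y : EuclideanSpace ℝ (Fin n), Real.exp (a * ‖y‖ / 4) * ‖g y‖ := by
  refine norm_integral_le_of_norm_le
    (Continuous.integrable_of_hasCompactSupport (by fun_prop) hgs.norm.mul_left) ?_
  refine Eventually.of_forall fun y => ?_
  rw [norm_mul]
  gcongr
  rw [Complex.norm_exp, Real.exp_le_exp]
  have e1 : (-Complex.I * (((⟪x, y⟫ / (2 * T) : ℝ) : ℂ) +
        z * ((⟪e, y⟫ / (2 * T) : ℝ) : ℂ))).re = z.im * (⟪e, y⟫ / (2 * T)) := by
    rw [neg_mul, Complex.neg_re, Complex.I_mul_re, Complex.add_im, Complex.im_mul_ofReal,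
      Complex.ofReal_im]
    ring
  rw [e1]
  calc z.im * (⟪e, y⟫ / (2 * T)) ≤ |z.im * (⟪e, y⟫ / (2 * T))| := le_abs_self _
    _ = |z.im| * (|⟪e, y⟫| / (2 * T)) := by
        rw [abs_mul, abs_div, abs_of_pos (by positivity : 0 < 2 * T)]
    _ ≤ |z.im| * ((‖e‖ * ‖y‖) / (2 * T)) := by
        gcongr
        exact abs_real_inner_le_norm e y
    _ = (|z.im| * ‖e‖) * (‖y‖ / (2 * T)) := by ring
    _ ≤ (a * T / 2) * (‖y‖ / (2 * T)) := by gcongr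
    _ = a * ‖y‖ / 4 := by field_simp; ring

theorem ucb_lip (n : ℕ) (g : EuclideanSpace ℝ (Fin n) → ℂ) (hg : Continuous g)
    (hgs : HasCompactSupport g) (x x₁ : EuclideanSpace ℝ (Fin n)) (a T : ℝ) (ha : 0 < a)
    (hT : 0 < T) :
    ‖(∫ y : EuclideanSpace ℝ (Fin n),
      Complex.exp (-Complex.I * ((⟪x, y⟫ / (2 * T) : ℝ) : ℂ)) * g y) -
      ∫ y : EuclideanSpace ℝ (Fin n),
      Complex.exp (-Complex.I * ((⟪x₁, y⟫ / (2 * T) : ℝ) : ℂ)) * g y‖ ≤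
      2 / (a * T) * ‖x - x₁‖ *
      ∫ y : EuclideanSpace ℝ (Fin n), Real.exp (a * ‖y‖ / 4) * ‖g y‖ := by
  have hi : ∀ x : EuclideanSpace ℝ (Fin n), Integrable (fun y : EuclideanSpace ℝ (Fin n) =>
      Complex.exp (-Complex.I * ((⟪x, y⟫ / (2 * T) : ℝ) : ℂ)) * g y) := fun x =>
    Continuous.integrable_of_hasCompactSupport (by fun_prop) hgs.mul_left
  rw [← integral_sub (hi x) (hi x₁), ← integral_const_mul]
  refine norm_integral_le_of_norm_le
    ((Continuous.integrable_of_hasCompactSupport (by fun_prop) hgs.norm.mul_left).const_mul _) ?_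
  refine Eventually.of_forall fun y => ?_
  rw [← sub_mul, norm_mul, ← mul_assoc]
  gcongr
  have e1 : Complex.exp (-Complex.I * ((⟪x, y⟫ / (2 * T) : ℝ) : ℂ)) -
      Complex.exp (-Complex.I * ((⟪x₁, y⟫ / (2 * T) : ℝ) : ℂ)) =
      Complex.exp (((-⟪x₁, y⟫ / (2 * T) : ℝ) : ℂ) * Complex.I) *
      (Complex.exp (Complex.I * ((-⟪x - x₁, y⟫ / (2 * T) : ℝ) : ℂ)) - 1) := by
    rw [mul_sub, ← Complex.exp_add, mul_one, inner_sub_left]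
    congr 2 <;> push_cast <;> ring
  rw [e1, norm_mul, Complex.norm_exp_ofReal_mul_I, one_mul]
  refine (Real.norm_exp_I_mul_ofReal_sub_one_le).trans ?_
  rw [Real.norm_eq_abs, abs_div, abs_neg, abs_of_pos (by positivity : 0 < 2 * T)]
  have h2 : a * ‖y‖ / 4 ≤ Real.exp (a * ‖y‖ / 4) := by
    have := Real.add_one_le_exp (a * ‖y‖ / 4); linarith
  calc |⟪x - x₁, y⟫| / (2 * T) ≤ ‖x - x₁‖ * ‖y‖ / (2 * T) := by
        gcongr
        exact abs_real_inner_le_norm _ _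
    _ = 2 / (a * T) * ‖x - x₁‖ * (a * ‖y‖ / 4) := by field_simp; ring
    _ ≤ _ := by gcongr

theorem ucb_exp_int (n : ℕ) :
    Integrable (fun y : EuclideanSpace ℝ (Fin n) => Real.exp (-‖y‖ / 2)) := by
  have h1 : Integrable (fun y : EuclideanSpace ℝ (Fin n) =>
      (2 * ((n : ℝ) + 1)) ^ (n + 1) * (1 + ‖y‖) ^ (-((n : ℝ) + 1))) := by
    refine (integrable_one_add_norm ?_).const_mul _
    simp [finrank_euclideanSpace]
  refine h1.mono' (Continuous.aestronglyMeasurable (by fun_prop)) ?_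
  refine Eventually.of_forall fun y => ?_
  rw [Real.norm_of_nonneg (Real.exp_pos _).le, neg_div, Real.exp_neg,
    Real.rpow_neg (by positivity), ← div_eq_mul_inv, inv_le_comm₀ (by positivity) (by positivity),
    inv_div]
  have e : (1 + ‖y‖) ^ ((n : ℝ) + 1) = (1 + ‖y‖) ^ (n + 1) := by
    exact_mod_cast Real.rpow_natCast (1 + ‖y‖) (n + 1)
  rw [e, ← div_pow]
  have e2 : Real.exp (‖y‖ / 2) = Real.exp (‖y‖ / (2 * ((n : ℝ) + 1))) ^ (n + 1) := by
    rw [← Real.exp_nat_mul]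
    congr 1
    push_cast
    field_simp
  rw [e2]
  gcongr
  have := Real.add_one_le_exp (‖y‖ / (2 * ((n : ℝ) + 1)))
  refine le_trans ?_ this
  rw [add_div, add_comm]
  gcongr
  rw [div_le_one (by positivity)]
  have : (0:ℝ) ≤ n := by positivity
  linarith

theorem ucb_cs (n : ℕ) (g : EuclideanSpace ℝ (Fin n) → ℂ) (hg : Continuous g)
    (hgs : HasCompactSupport g) (a : ℝ) (ha : 0 < a) :
    (∫ y : EuclideanSpace ℝ (Fin n), Real.exp (a * ‖y‖ / 4) * ‖g y‖) ^ 2 ≤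
      ((∫ y : EuclideanSpace ℝ (Fin n), Real.exp (-‖y‖ / 2)) * (a ^ n)⁻¹) *
      ∫ y : EuclideanSpace ℝ (Fin n), Real.exp (a * ‖y‖) * ‖g y‖ ^ 2 := by
  have hI : Integrable (fun y : EuclideanSpace ℝ (Fin n) => Real.exp (-‖a • y‖ / 2)) :=
    (ucb_exp_int n).comp_smul ha.ne'
  have hIe : ∫ y : EuclideanSpace ℝ (Fin n), Real.exp (-‖a • y‖ / 2) =
      (∫ y : EuclideanSpace ℝ (Fin n), Real.exp (-‖y‖ / 2)) * (a ^ n)⁻¹ := by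
    rw [Measure.integral_comp_smul volume
      (fun y : EuclideanSpace ℝ (Fin n) => Real.exp (-‖y‖ / 2)) a]
    rw [finrank_euclideanSpace, Fintype.card_fin, abs_of_pos (by positivity), smul_eq_mul, mul_comm]
  have h := integral_mul_le_Lp_mul_Lq_of_nonneg (μ := (volume : Measure (EuclideanSpace ℝ (Fin n))))
    Real.HolderConjugate.two_two
    (f := fun y => Real.exp (-(a * ‖y‖) / 4)) (g := fun y => Real.exp (a * ‖y‖ / 2) * ‖g y‖)
    (Eventually.of_forall fun y => by positivity) (Eventually.of_forall fun y => by positivity)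
    ?_ ?_
  · have e1 : ∀ y : EuclideanSpace ℝ (Fin n),
      Real.exp (-(a * ‖y‖) / 4) * (Real.exp (a * ‖y‖ / 2) * ‖g y‖) =
        Real.exp (a * ‖y‖ / 4) * ‖g y‖ := by
      intro y
      rw [← mul_assoc, ← Real.exp_add]
      congr 2; ring
    have e2 : ∀ y : EuclideanSpace ℝ (Fin n),
      Real.exp (-(a * ‖y‖) / 4) ^ (2 : ℝ) = Real.exp (-‖a • y‖ / 2) := by
      intro y
      rw [Real.rpow_two, ← Real.exp_nat_mul, norm_smul, Real.norm_of_nonneg ha.le]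
      congr 1; push_cast; ring
    have e3 : ∀ y : EuclideanSpace ℝ (Fin n),
      (Real.exp (a * ‖y‖ / 2) * ‖g y‖) ^ (2 : ℝ) = Real.exp (a * ‖y‖) * ‖g y‖ ^ 2 := by
      intro y
      rw [Real.rpow_two, mul_pow, ← Real.exp_nat_mul]
      congr 2; push_cast; ring
    simp_rw [e1, e2, e3] at h
    rw [hIe, ← Real.sqrt_eq_rpow, ← Real.sqrt_eq_rpow] at h
    have h0 : 0 ≤ ∫ y : EuclideanSpace ℝ (Fin n), Real.exp (a * ‖y‖ / 4) * ‖g y‖ :=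
      integral_nonneg fun y => by positivity
    have h3 : 0 ≤ ∫ y : EuclideanSpace ℝ (Fin n), Real.exp (a * ‖y‖) * ‖g y‖ ^ 2 :=
      integral_nonneg fun y => by positivity
    have h4 : 0 ≤ ∫ y : EuclideanSpace ℝ (Fin n), Real.exp (-‖y‖ / 2) :=
      integral_nonneg fun y => by positivity
    have := pow_le_pow_left₀ h0 h 2
    rwa [mul_pow, Real.sq_sqrt (by positivity), Real.sq_sqrt h3] at this
  · rw [show ENNReal.ofReal 2 = 2 by simp]
    rw [memLp_two_iff_integrable_sq (Continuous.aestronglyMeasurable (by fun_prop))]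
    refine hI.congr (Eventually.of_forall fun y => ?_)
    simp only
    rw [← Real.exp_nat_mul, norm_smul, Real.norm_of_nonneg ha.le]
    congr 1; push_cast; ring
  · exact Continuous.memLp_of_hasCompactSupport (by fun_prop) hgs.norm.mul_left

theorem ucb_small (n : ℕ) (F : EuclideanSpace ℝ (Fin n) → ℝ) (hF : Continuous F)
    (hF0 : ∀ x, 0 ≤ F x) (K ρ r₁ : ℝ) (hK : 0 < K) (hρ : 0 < ρ) (hr : ρ ≤ r₁)
    (hFK : ∀ x, F x ≤ K) (hL : ∀ x y, F x - F y ≤ 2 * K / ρ * ‖x - y‖)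
    (x' y : EuclideanSpace ℝ (Fin n)) (hy : ‖y - x'‖ ≤ ρ / 2) :
    (F y / K) ^ (n + 2) ≤
      (4 * 4 ^ n / volume.real (closedBall (0 : EuclideanSpace ℝ (Fin n)) 1)) *
      ((∫ x in closedBall x' r₁, F x ^ 2) / (ρ ^ n * K ^ 2)) := by
  set ω := volume.real (closedBall (0 : EuclideanSpace ℝ (Fin n)) 1) with hω
  have hωpos : 0 < ω := by
    rw [hω, measureReal_def]
    refine ENNReal.toReal_pos ?_ measure_closedBall_lt_top.ne
    exact (measure_closedBall_pos volume _ one_pos).ne'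
  set m := F y with hm
  have hm0 : 0 ≤ m := hF0 y
  set r := m * ρ / (4 * K) with hrdef
  have hr0 : 0 ≤ r := by positivity
  have hmK : m / K ≤ 1 := (div_le_one hK).2 (hFK y)
  have hr4 : r ≤ ρ / 4 := by
    have : r = (m / K) * (ρ / 4) := by rw [hrdef]; field_simp
    rw [this]
    exact mul_le_of_le_one_left (by positivity) hmK
  have hvol : volume.real (closedBall y r) = r ^ n * ω := by
    rw [Measure.addHaar_real_closedBall' volume y hr0, finrank_euclideanSpace, Fintype.card_fin]
  have hint : ∀ c s, IntegrableOn (fun x => F x ^ 2) (closedBall c s) := fun c s =>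
    (hF.pow 2).continuousOn.integrableOn_compact (isCompact_closedBall c s)
  have h1 : ∫ x in closedBall y r, F x ^ 2 ≤ ∫ x in closedBall x' r₁, F x ^ 2 := by
    refine setIntegral_mono_set (hint _ _) (Eventually.of_forall fun x => sq_nonneg _) ?_
    refine LE.le.eventuallyLE ?_
    refine closedBall_subset_closedBall' ?_
    rw [dist_eq_norm]
    linarith
  have h2 : r ^ n * ω * (m / 2) ^ 2 ≤ ∫ x in closedBall y r, F x ^ 2 := by
    have : ∫ x in closedBall y r, (m / 2) ^ 2 = r ^ n * ω * (m / 2) ^ 2 := by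
      rw [setIntegral_const, hvol, smul_eq_mul]
    rw [← this]
    refine setIntegral_mono_on ?_ (hint _ _) measurableSet_closedBall ?_
    · exact continuousOn_const.integrableOn_compact (isCompact_closedBall _ _)
    · intro x hx
      have hx' : ‖y - x‖ ≤ r := by rw [← dist_eq_norm, dist_comm]; exact hx
      have h3 := hL y x
      have h4 : 2 * K / ρ * ‖y - x‖ ≤ 2 * K / ρ * r := by gcongr
      have h5 : 2 * K / ρ * r = m / 2 := by rw [hrdef]; field_simp; ring
      have : m / 2 ≤ F x := by rw [← hm] at h3; linarith
      gcongr
  have h6 := h2.trans h1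
  set I := ∫ x in closedBall x' r₁, F x ^ 2
  have e : (m / K) ^ (n + 2) = (4 * 4 ^ n / ω) * ((r ^ n * ω * (m / 2) ^ 2) / (ρ ^ n * K ^ 2)) := by
    rw [hrdef, div_pow, div_pow, mul_pow, mul_pow, pow_add, pow_add, div_pow]
    field_simp
    norm_num
  rw [e]
  gcongr

theorem ucb_algebra (n : ℕ) (ρ K I M C1 C2 α : ℝ) (hρ : 0 < ρ) (hK : 0 < K) (hI : 0 ≤ I)
    (hM : 0 ≤ M) (hC1 : 1 ≤ C1) (hC2 : 1 ≤ C2) (hα0 : 0 ≤ α) (hα1 : α ≤ 1)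
    (hKM : K ^ 2 ≤ C2 * (ρ ^ n)⁻¹ * M) :
    K ^ 2 * (C1 * (I / (ρ ^ n * K ^ 2))) ^ α ≤ C1 * C2 * (ρ ^ n)⁻¹ * I ^ α * M ^ (1 - α) := by
  have hK2 : 0 < K ^ 2 := by positivity
  have hR : 0 < (ρ ^ n)⁻¹ := by positivity
  set R := (ρ ^ n)⁻¹ with hRdef
  have e0 : C1 * (I / (ρ ^ n * K ^ 2)) = C1 * I * R * (K ^ 2)⁻¹ := by
    rw [hRdef]; field_simp
  have e1 : K ^ 2 * (C1 * (I / (ρ ^ n * K ^ 2))) ^ α = C1 ^ α * I ^ α * R ^ α * (K ^ 2) ^ (1 - α) := by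
    rw [e0, Real.mul_rpow (by positivity) (by positivity), Real.mul_rpow (by positivity) (by positivity),
      Real.mul_rpow (by positivity) (by positivity), Real.inv_rpow hK2.le, Real.rpow_sub hK2,
      Real.rpow_one]
    field_simp
  have e2 : (K ^ 2) ^ (1 - α) ≤ C2 ^ (1 - α) * R ^ (1 - α) * M ^ (1 - α) := by
    rw [← Real.mul_rpow (by positivity) (by positivity), ← Real.mul_rpow (by positivity) (by positivity)]
    exact Real.rpow_le_rpow hK2.le hKM (by linarith)
  have e3 : C1 ^ α ≤ C1 := by
    simpa using Real.rpow_le_rpow_of_exponent_le hC1 hα1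
  have e4 : C2 ^ (1 - α) ≤ C2 := by
    simpa using Real.rpow_le_rpow_of_exponent_le hC2 (by linarith : 1 - α ≤ 1)
  have e5 : R ^ α * R ^ (1 - α) = R := by rw [← Real.rpow_add hR]; simp
  rw [e1]
  calc C1 ^ α * I ^ α * R ^ α * (K ^ 2) ^ (1 - α)
      ≤ C1 ^ α * I ^ α * R ^ α * (C2 ^ (1 - α) * R ^ (1 - α) * M ^ (1 - α)) := by gcongr
    _ = C1 ^ α * C2 ^ (1 - α) * (R ^ α * R ^ (1 - α)) * I ^ α * M ^ (1 - α) := by ring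
    _ ≤ C1 * C2 * R * I ^ α * M ^ (1 - α) := by rw [e5]; gcongr

theorem ucb_exponent (n : ℕ) (D p : ℝ) (hD : 0 ≤ D) (hp : 1 + D ≤ p) :
    (((1 / 2 : ℝ) ^ (32 : ℝ) / (n + 2)) ^ p) ≤ (1 / 2 : ℝ) ^ (⌈32 * D⌉₊) * (1 / ((n : ℝ) + 2)) := by
  have hn : (0 : ℝ) ≤ n := by positivity
  have hθ0 : 0 < (1 / 2 : ℝ) ^ (32 : ℝ) / (n + 2) := by positivity
  have h2 : (1 / 2 : ℝ) ^ (32 : ℝ) ≤ 1 := Real.rpow_le_one (by norm_num) (by norm_num) (by norm_num)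
  have hθh : (1 / 2 : ℝ) ^ (32 : ℝ) / (n + 2) ≤ (1 / 2 : ℝ) ^ (32 : ℝ) :=
    div_le_self (by positivity) (by linarith)
  have hθ1 : (1 / 2 : ℝ) ^ (32 : ℝ) / (n + 2) ≤ 1 := hθh.trans h2
  calc (((1 / 2 : ℝ) ^ (32 : ℝ) / (n + 2)) ^ p) ≤ ((1 / 2 : ℝ) ^ (32 : ℝ) / (n + 2)) ^ (1 + D) :=
        Real.rpow_le_rpow_of_exponent_ge hθ0 hθ1 hp
    _ = ((1 / 2 : ℝ) ^ (32 : ℝ) / (n + 2)) * ((1 / 2 : ℝ) ^ (32 : ℝ) / (n + 2)) ^ D := by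
        rw [Real.rpow_add hθ0, Real.rpow_one]
    _ ≤ ((1 / 2 : ℝ) ^ (32 : ℝ) / (n + 2)) * ((1 / 2 : ℝ) ^ (32 : ℝ)) ^ D := by gcongr
    _ = (1 / 2 : ℝ) ^ (32 + 32 * D) * (1 / ((n : ℝ) + 2)) := by
        rw [← Real.rpow_mul (by norm_num), Real.rpow_add (by norm_num)]; ring
    _ ≤ (1 / 2 : ℝ) ^ ((⌈32 * D⌉₊ : ℕ) : ℝ) * (1 / ((n : ℝ) + 2)) := by
        have : (⌈32 * D⌉₊ : ℝ) < 32 * D + 1 := Nat.ceil_lt_add_one (by positivity)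
        have := Real.rpow_le_rpow_of_exponent_ge (by norm_num : (0:ℝ) < 1 / 2) (by norm_num)
          (by linarith : (⌈32 * D⌉₊ : ℝ) ≤ 32 + 32 * D)
        gcongr
    _ = _ := by rw [Real.rpow_natCast]

theorem ucb_main (n : ℕ) (g : EuclideanSpace ℝ (Fin n) → ℂ) (hg : Continuous g)
    (hgs : HasCompactSupport g) (a T r₁ r₂ κ : ℝ) (ha : 0 < a) (hT : 0 < T) (hr₁ : 0 < r₁)
    (hr₂ : 0 < r₂) (hκ : 0 < κ) (x' x'' : EuclideanSpace ℝ (Fin n))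
    (F : EuclideanSpace ℝ (Fin n) → ℝ)
    (hFdef : ∀ x, F x = κ * ‖∫ y : EuclideanSpace ℝ (Fin n),
      Complex.exp (-Complex.I * ((⟪x, y⟫ / (2 * T) : ℝ) : ℂ)) * g y‖)
    (C1 C2 M α : ℝ) (hC1 : 1 ≤ C1) (hC2 : 1 ≤ C2) (hM : 0 ≤ M)
    (hC1' : 4 * 4 ^ n / volume.real (closedBall (0 : EuclideanSpace ℝ (Fin n)) 1) ≤ C1)
    (hKM : (κ * ∫ y : EuclideanSpace ℝ (Fin n), Real.exp (a * ‖y‖ / 4) * ‖g y‖) ^ 2 ≤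
      C2 * ((min (a * T) r₁) ^ n)⁻¹ * M)
    (hα0 : 0 ≤ α) (hα1 : α ≤ 1)
    (hα : α ≤ (1 / 2 : ℝ) ^ (⌈32 * ((‖x' - x''‖ + r₂) / min (a * T) r₁)⌉₊) * (1 / ((n : ℝ) + 2))) :
    ∫ x in closedBall x'' r₂, F x ^ 2 ≤
      (volume.real (closedBall (0 : EuclideanSpace ℝ (Fin n)) 1) * (C1 * C2)) * r₂ ^ n *
        ((min (a * T) r₁) ^ n)⁻¹ * (∫ x in closedBall x' r₁, F x ^ 2) ^ α * M ^ (1 - α) := by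
  set ρ := min (a * T) r₁ with hρdef
  have hρ : 0 < ρ := lt_min (by positivity) hr₁
  have hρa : ρ ≤ a * T := min_le_left _ _
  have hρr : ρ ≤ r₁ := min_le_right _ _
  set ω := volume.real (closedBall (0 : EuclideanSpace ℝ (Fin n)) 1) with hω
  set K := κ * ∫ y : EuclideanSpace ℝ (Fin n), Real.exp (a * ‖y‖ / 4) * ‖g y‖ with hKdef
  set I := ∫ x in closedBall x' r₁, F x ^ 2 with hIdef
  have hω0 : 0 ≤ ω := measureReal_nonneg
  have hI0 : 0 ≤ I := integral_nonneg fun x => sq_nonneg _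
  have hF0 : ∀ x, 0 ≤ F x := fun x => by rw [hFdef]; positivity
  have hline : ∀ x e : EuclideanSpace ℝ (Fin n), ∀ t : ℝ, F (x + t • e) =
      κ * ‖∫ y : EuclideanSpace ℝ (Fin n), Complex.exp (-Complex.I * (((⟪x, y⟫ / (2 * T) : ℝ) : ℂ) +
        (t : ℂ) * ((⟪e, y⟫ / (2 * T) : ℝ) : ℂ))) * g y‖ := by
    intro x e t
    rw [hFdef]
    congr 3
    ext y
    congr 3
    rw [inner_add_left, real_inner_smul_left]
    push_cast
    ring
  have hFK : ∀ x, F x ≤ K := by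
    intro x
    have h1 := hline x 0 0
    simp only [smul_zero, add_zero] at h1
    rw [h1, hKdef]
    gcongr
    exact ucb_bound n g hg hgs x 0 a T ha hT (0 : ℝ) (by simp; positivity)
  have hK0 : 0 ≤ K := (hF0 0).trans (hFK 0)
  rcases hK0.eq_or_lt with hK | hK
  · have : ∀ x, F x = 0 := fun x => le_antisymm (by rw [hK]; exact hFK x) (hF0 x)
    simp only [this]
    simp only [ne_eq, OfNat.ofNat_ne_zero, not_false_eq_true, zero_pow, integral_zero]
    positivity
  have hL : ∀ x y, F x - F y ≤ 2 * K / ρ * ‖x - y‖ := by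
    intro x y
    rw [hFdef, hFdef, ← mul_sub]
    have h1 := ucb_lip n g hg hgs x y a T ha hT
    have h2 := (norm_sub_norm_le _ _).trans h1
    have h3 : 2 / (a * T) ≤ 2 / ρ := by gcongr
    have h0 : 0 ≤ ∫ y : EuclideanSpace ℝ (Fin n), Real.exp (a * ‖y‖ / 4) * ‖g y‖ :=
      integral_nonneg fun y => by positivity
    calc _ ≤ κ * (2 / (a * T) * ‖x - y‖ *
          ∫ y : EuclideanSpace ℝ (Fin n), Real.exp (a * ‖y‖ / 4) * ‖g y‖) := by gcongr
      _ ≤ κ * (2 / ρ * ‖x - y‖ *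
          ∫ y : EuclideanSpace ℝ (Fin n), Real.exp (a * ‖y‖ / 4) * ‖g y‖) := by gcongr
      _ = _ := by rw [hKdef]; ring
  have hFc : Continuous F := by
    refine (LipschitzWith.of_dist_le_mul (K := (2 * K / ρ).toNNReal) fun x y => ?_).continuous
    rw [Real.dist_eq, dist_eq_norm, Real.coe_toNNReal _ (by positivity), abs_le]
    constructor
    · have := hL y x
      rw [norm_sub_rev] at this
      linarith
    · exact hL x y
  set q := min 1 (C1 * (I / (ρ ^ n * K ^ 2))) with hqdef
  have hq0 : 0 ≤ q := le_min zero_le_one (by positivity)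
  have hq1 : q ≤ 1 := min_le_left _ _
  have hq2 : q ≤ C1 * (I / (ρ ^ n * K ^ 2)) := min_le_right _ _
  have hn2 : (0 : ℝ) < (n : ℝ) + 2 := by positivity
  have hball : ∀ y, ‖y - x'‖ ≤ ρ / 2 → F y ≤ K * q ^ (1 / ((n : ℝ) + 2)) := by
    intro y hy
    have h1 := ucb_small n F hFc hF0 K ρ r₁ hK hρ hρr hFK hL x' y hy
    have h2 : 0 ≤ F y / K := div_nonneg (hF0 y) hK.le
    have h3 : (F y / K) ^ (n + 2) ≤ q := by
      refine le_min (pow_le_one₀ h2 ((div_le_one hK).2 (hFK y))) (h1.trans ?_)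
      gcongr
    have h4 : F y / K ≤ q ^ (1 / ((n : ℝ) + 2)) := by
      have h5 := Real.rpow_le_rpow (by positivity) h3 (by positivity : 0 ≤ 1 / ((n : ℝ) + 2))
      have h6 := Real.pow_rpow_inv_natCast h2 (by omega : n + 2 ≠ 0)
      push_cast at h6
      rw [one_div] at h5 ⊢
      rwa [h6] at h5
    rw [div_le_iff₀ hK] at h4
    linarith
  have hpt : ∀ x ∈ closedBall x'' r₂, F x ^ 2 ≤ K ^ 2 * (C1 * (I / (ρ ^ n * K ^ 2))) ^ α := by
    intro x hx
    set D := (‖x' - x''‖ + r₂) / ρ with hD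
    set k := ⌈32 * D⌉₊ with hk
    set d := ‖x - x'‖ / ρ with hd
    set e := d⁻¹ • (x - x') with he
    have hd0 : 0 ≤ d := by positivity
    have hdD : d ≤ D := by
      rw [hd, hD]
      gcongr
      have h1 : ‖x - x''‖ ≤ r₂ := by rw [← dist_eq_norm]; exact hx
      have h2 : x - x' = (x - x'') - (x' - x'') := by abel
      rw [h2]
      have := norm_sub_le (x - x'') (x' - x'')
      linarith
    have hdk : d ≤ 1 / 2 + k / 32 := by
      have : 32 * D ≤ k := Nat.le_ceil _
      linarith
    have hxe : x = x' + d • e := by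
      by_cases hz : d = 0
      · have : ‖x - x'‖ = 0 := by
          rw [hd] at hz
          rcases div_eq_zero_iff.1 hz with h | h
          · exact h
          · exact absurd h hρ.ne'
        rw [norm_eq_zero, sub_eq_zero] at this
        rw [hz, zero_smul, add_zero, this]
      · rw [he, smul_smul, mul_inv_cancel₀ hz, one_smul]; abel
    have hee : ‖e‖ ≤ ρ := by
      rw [he, norm_smul, norm_inv, Real.norm_of_nonneg hd0]
      by_cases hz : ‖x - x'‖ = 0
      · rw [hz, mul_zero]; exact hρ.le
      · rw [hd]; apply le_of_eq; field_simp
    let H : ℂ → ℂ := fun s => (κ : ℂ) * ∫ y : EuclideanSpace ℝ (Fin n),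
      Complex.exp (-Complex.I * (((⟪x', y⟫ / (2 * T) : ℝ) : ℂ) +
        s * ((⟪e, y⟫ / (2 * T) : ℝ) : ℂ))) * g y
    have hHF : ∀ t : ℝ, ‖H t‖ = F (x' + t • e) := by
      intro t
      rw [hline, norm_mul, Complex.norm_real, Real.norm_of_nonneg hκ.le]
    have hHd : Differentiable ℂ H := by
      refine Differentiable.const_mul ?_ _
      exact ucb_diff n g hg hgs (fun y => ⟪x', y⟫ / (2 * T)) (fun y => ⟪e, y⟫ / (2 * T))
        (by fun_prop) (by fun_prop)
    have it := ucb_iter H hHd K (q ^ (1 / ((n : ℝ) + 2))) hK (by positivity)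
      (Real.rpow_le_one hq0 hq1 (by positivity))
      (by
        intro z hz
        simp only [H]
        rw [norm_mul, Complex.norm_real, Real.norm_of_nonneg hκ.le, hKdef]
        gcongr
        refine ucb_bound n g hg hgs x' e a T ha hT z ?_
        calc |z.im| * ‖e‖ ≤ 1 / 2 * (a * T) := by gcongr; exact hee.trans hρa
          _ = a * T / 2 := by ring)
      (by
        intro t ht0 ht1
        rw [hHF]
        apply hball
        rw [add_sub_cancel_left, norm_smul, Real.norm_of_nonneg ht0]
        calc t * ‖e‖ ≤ 1 / 2 * ρ := by gcongr
          _ = ρ / 2 := by ring)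
      k d hd0 hdk
    rw [hHF, ← hxe, ← Real.rpow_mul hq0] at it
    have h7 : q ^ (1 / ((n : ℝ) + 2) * (1 / 2) ^ k) ≤ q ^ α :=
      Real.rpow_le_rpow_of_exponent_ge' hq0 hq1 hα0 (by linarith)
    have h7' : q ^ (1 / ((n : ℝ) + 2) * (1 / 2) ^ k) ≤ 1 := Real.rpow_le_one hq0 hq1 (by positivity)
    have h7'' : 0 ≤ q ^ (1 / ((n : ℝ) + 2) * (1 / 2) ^ k) := by positivity
    calc F x ^ 2 ≤ (K * q ^ (1 / ((n : ℝ) + 2) * (1 / 2) ^ k)) ^ 2 :=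
          pow_le_pow_left₀ (hF0 x) it 2
      _ = K ^ 2 * (q ^ (1 / ((n : ℝ) + 2) * (1 / 2) ^ k)) ^ 2 := by ring
      _ ≤ K ^ 2 * q ^ (1 / ((n : ℝ) + 2) * (1 / 2) ^ k) := by
          gcongr
          nlinarith
      _ ≤ K ^ 2 * q ^ α := by gcongr
      _ ≤ _ := by gcongr
  have halg := ucb_algebra n ρ K I M C1 C2 α hρ hK hI0 hM hC1 hC2 hα0 hα1 hKM
  calc ∫ x in closedBall x'' r₂, F x ^ 2
      ≤ ∫ x in closedBall x'' r₂, K ^ 2 * (C1 * (I / (ρ ^ n * K ^ 2))) ^ α := by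
        refine setIntegral_mono_on
          ((hFc.pow 2).continuousOn.integrableOn_compact (isCompact_closedBall _ _))
          (continuousOn_const.integrableOn_compact (isCompact_closedBall _ _))
          measurableSet_closedBall hpt
    _ = r₂ ^ n * ω * (K ^ 2 * (C1 * (I / (ρ ^ n * K ^ 2))) ^ α) := by
        rw [setIntegral_const, Measure.addHaar_real_closedBall' volume _ hr₂.le,
          finrank_euclideanSpace, Fintype.card_fin, smul_eq_mul]
    _ ≤ r₂ ^ n * ω * (C1 * C2 * (ρ ^ n)⁻¹ * I ^ α * M ^ (1 - α)) := by gcongr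
    _ = _ := by ring

/-- Theorem 1.3: there are `C = C(n) > 0` and `θ = θ(n) ∈ (0,1)` such that for all
`x', x'' ∈ ℝⁿ`, `r₁, r₂ > 0`, `a > 0`, `T > 0` and `u₀ ∈ C₀^∞(ℝⁿ;ℂ)`, with
`p = 1 + (|x'-x''| + r₁ + r₂)/((aT) ∧ r₁)`,
`∫_{B_{r₂}(x'')}|u(·,T;u₀)|² ≤ C r₂ⁿ ((aT) ∧ r₁)^{-n}
  (∫_{B_{r₁}(x')}|u(·,T;u₀)|²)^{θ^p} (∫ e^{a|x|}|u₀|²)^{1-θ^p}`. -/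
theorem unique_continuation_ball_to_ball (n : ℕ) (hn : 1 ≤ n) :
    ∃ C > (0 : ℝ), ∃ θ : ℝ, θ ∈ Set.Ioo (0 : ℝ) 1 ∧
      ∀ (x' x'' : EuclideanSpace ℝ (Fin n)) (r₁ r₂ a T : ℝ),
        0 < r₁ → 0 < r₂ → 0 < a → 0 < T →
          ∀ u₀ : EuclideanSpace ℝ (Fin n) → ℂ, IsTestFun n u₀ →
            (∫ x in closedBall x'' r₂, ‖schrodingerSol n u₀ T x‖ ^ 2) ≤
              C * r₂ ^ n * ((min (a * T) r₁) ^ n)⁻¹ *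
                (∫ x in closedBall x' r₁, ‖schrodingerSol n u₀ T x‖ ^ 2) ^
                  (θ ^ (1 + (‖x' - x''‖ + r₁ + r₂) / min (a * T) r₁)) *
                (∫ x, Real.exp (a * ‖x‖) * ‖u₀ x‖ ^ 2) ^
                  (1 - θ ^ (1 + (‖x' - x''‖ + r₁ + r₂) / min (a * T) r₁)) := by
  have hω : 0 < volume.real (closedBall (0 : EuclideanSpace ℝ (Fin n)) 1) := by
    rw [measureReal_def]
    refine ENNReal.toReal_pos ?_ measure_closedBall_lt_top.ne
    exact (measure_closedBall_pos volume _ one_pos).ne'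
  set ω := volume.real (closedBall (0 : EuclideanSpace ℝ (Fin n)) 1) with hωdef
  set E0 := ∫ y : EuclideanSpace ℝ (Fin n), Real.exp (-‖y‖ / 2) with hE0
  have hE0n : 0 ≤ E0 := integral_nonneg fun y => by positivity
  set C1 := max 1 (4 * 4 ^ n / ω) with hC1
  set C2 := max 1 (E0 * ((4 * π) ^ n)⁻¹) with hC2
  have hC1' : 1 ≤ C1 := le_max_left _ _
  have hC2' : 1 ≤ C2 := le_max_left _ _
  have hn0 : (0 : ℝ) ≤ n := by positivity
  have hhalf : (1 / 2 : ℝ) ^ (32 : ℝ) ≤ 1 :=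
    Real.rpow_le_one (by norm_num) (by norm_num) (by norm_num)
  have hθ0 : 0 < (1 / 2 : ℝ) ^ (32 : ℝ) / (n + 2) := by positivity
  have hθ1 : (1 / 2 : ℝ) ^ (32 : ℝ) / (n + 2) < 1 := by
    rw [div_lt_one (by positivity)]
    linarith
  refine ⟨ω * (C1 * C2), by positivity, (1 / 2 : ℝ) ^ (32 : ℝ) / (n + 2), ⟨hθ0, hθ1⟩, ?_⟩
  intro x' x'' r₁ r₂ a T hr₁ hr₂ ha hT u₀ hu
  have hρ : 0 < min (a * T) r₁ := lt_min (by positivity) hr₁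
  have hD : 0 ≤ (‖x' - x''‖ + r₂) / min (a * T) r₁ := by positivity
  have hp : 1 + (‖x' - x''‖ + r₂) / min (a * T) r₁ ≤
      1 + (‖x' - x''‖ + r₁ + r₂) / min (a * T) r₁ := by
    gcongr
    linarith
  have hcu : Continuous u₀ := hu.1.continuous
  have hcs : HasCompactSupport u₀ := hu.2
  have hgn : ∀ y : EuclideanSpace ℝ (Fin n),
      ‖Complex.exp (Complex.I * ((‖y‖ ^ 2 / (4 * T) : ℝ) : ℂ)) * u₀ y‖ = ‖u₀ y‖ := by
    intro y
    rw [norm_mul, mul_comm Complex.I, Complex.norm_exp_ofReal_mul_I, one_mul]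
  have hgc : Continuous (fun y : EuclideanSpace ℝ (Fin n) =>
      Complex.exp (Complex.I * ((‖y‖ ^ 2 / (4 * T) : ℝ) : ℂ)) * u₀ y) := by fun_prop
  have hgs : HasCompactSupport (fun y : EuclideanSpace ℝ (Fin n) =>
      Complex.exp (Complex.I * ((‖y‖ ^ 2 / (4 * T) : ℝ) : ℂ)) * u₀ y) := hcs.mul_left
  refine ucb_main n (fun y => Complex.exp (Complex.I * ((‖y‖ ^ 2 / (4 * T) : ℝ) : ℂ)) * u₀ y)
    hgc hgs a T r₁ r₂ ((4 * π * T) ^ (-(n : ℝ) / 2)) ha hT hr₁ hr₂ (by positivity) x' x''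
    (fun x => ‖schrodingerSol n u₀ T x‖) (fun x => ucb_sol_norm n u₀ hu T hT x) C1 C2 _ _ hC1' hC2'
    (integral_nonneg fun y => by positivity) (le_max_right _ _) ?_ (by positivity)
    (Real.rpow_le_one hθ0.le hθ1.le (by positivity)) (ucb_exponent n _ _ hD hp)
  have hcs2 := ucb_cs n _ hgc hgs a ha
  simp only [hgn] at hcs2 ⊢
  have hM : 0 ≤ ∫ y : EuclideanSpace ℝ (Fin n), Real.exp (a * ‖y‖) * ‖u₀ y‖ ^ 2 :=
    integral_nonneg fun y => by positivity
  have hκ : ((4 * π * T) ^ (-(n : ℝ) / 2)) ^ 2 = ((4 * π * T) ^ n)⁻¹ := by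
    rw [← Real.rpow_natCast, ← Real.rpow_mul (by positivity)]
    have : -(n : ℝ) / 2 * (2 : ℕ) = -(n : ℝ) := by push_cast; ring
    rw [this, Real.rpow_neg (by positivity), Real.rpow_natCast]
  rw [mul_pow, hκ]
  have hle : ((a * T) ^ n)⁻¹ ≤ ((min (a * T) r₁) ^ n)⁻¹ := by
    gcongr
    exact min_le_left _ _
  calc _ ≤ ((4 * π * T) ^ n)⁻¹ * (E0 * (a ^ n)⁻¹ *
        ∫ y : EuclideanSpace ℝ (Fin n), Real.exp (a * ‖y‖) * ‖u₀ y‖ ^ 2) := by gcongr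
    _ = (E0 * ((4 * π) ^ n)⁻¹) * ((a * T) ^ n)⁻¹ *
        ∫ y : EuclideanSpace ℝ (Fin n), Real.exp (a * ‖y‖) * ‖u₀ y‖ ^ 2 := by
        rw [mul_pow (4 * π) T, mul_pow a T, mul_inv, mul_inv]; ring
    _ ≤ C2 * ((min (a * T) r₁) ^ n)⁻¹ *
        ∫ y : EuclideanSpace ℝ (Fin n), Real.exp (a * ‖y‖) * ‖u₀ y‖ ^ 2 := by
        gcongr
        exact le_max_right _ _
end
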